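/- Let R be an integral domain of finite Krull dimension d such that the Krull dimension of the polynomial ring R[Y] equals d+1. Let f ∈ R[Y] be nonzero, let A = R[Y][f^{-1}] be the localization of R[Y] away from f, and let P be a finitely generated projective A-module of constant rank r ≥ max{2, d+1}. Then E(A ⊕ P) acts transitively on Um(A ⊕ P). -/

import Mathlib

open Polynomial

/-- An element `m` of an `A`-module `M` is unimodular if some linear functional sends it to `1`. -/
def IsUnimodular (A : Type*) [CommRing A] (M : Type*) [AddCommGroup M] [Module A M]
    (m : M) : Prop :=
  ∃ φ : M →ₗ[A] A, φ m = 1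

/-- `E(M)`: the subgroup of `Aut_A(M)` generated by transvections, i.e. automorphisms of the
form `q ↦ q + φ(q) • p` with `φ(p) = 0` and `p` unimodular or `φ` unimodular. -/
def TransvectionGroup (A : Type*) [CommRing A] (M : Type*) [AddCommGroup M] [Module A M] :
    Subgroup (M ≃ₗ[A] M) :=
  Subgroup.closure {σ : M ≃ₗ[A] M | ∃ (p : M) (φ : M →ₗ[A] A), φ p = 0 ∧
    (IsUnimodular A M p ∨ IsUnimodular A (M →ₗ[A] A) φ) ∧ ∀ q : M, σ q = q + φ q • p}

/-- A projective module has constant rank `r` if its localization at every prime is free of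
rank `r`. -/
def HasConstantRank (A : Type*) [CommRing A] (P : Type*) [AddCommGroup P] [Module A P]
    (r : ℕ) : Prop :=
  ∀ (𝔭 : Ideal A) (h𝔭 : 𝔭.IsPrime),
    haveI := h𝔭
    Module.Free (Localization.AtPrime 𝔭) (LocalizedModule 𝔭.primeCompl P) ∧
    Module.finrank (Localization.AtPrime 𝔭) (LocalizedModule 𝔭.primeCompl P) = r

/-- Property `Ω(R)` for a projective module `P` over an `R`-algebra `S`. -/
def PropertyOmega (R : Type*) [CommRing R] (S : Type*) [CommRing S] [Algebra R S]
    (P : Type*) [AddCommGroup P] [Module S P] : Prop :=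
  ∀ I : Ideal R, ∃ t : R,
    Ideal.Quotient.mk I t ∈ nonZeroDivisors (R ⧸ I) ∧
    Module.Free
      (Localization (Submonoid.powers
        (Ideal.Quotient.mk (I.map (algebraMap R S)) (algebraMap R S t))))
      (LocalizedModule (Submonoid.powers
        (Ideal.Quotient.mk (I.map (algebraMap R S)) (algebraMap R S t)))
        (P ⧸ ((I.map (algebraMap R S)) • ⊤ : Submodule S P)))


/-- Chains of primes containing `I` and disjoint from `S` have length `< n`. -/
def KD {A : Type*} [CommRing A] (S : Submonoid A) (I : Ideal A) (n : ℕ) : Prop :=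
  ∀ c : LTSeries (PrimeSpectrum A), I ≤ c.head.asIdeal →
    Disjoint (c.last.asIdeal : Set A) S → c.length < n

/-- The boundary ideal of `x` relative to `I`. -/
def bdry {A : Type*} [CommRing A] (I : Ideal A) (x : A) : Ideal A :=
  I ⊔ Ideal.span {x} ⊔ Submodule.comap (LinearMap.mulLeft A x) I.radical

lemma KD.bdry {A : Type*} [CommRing A] {S : Submonoid A} {I : Ideal A} {n : ℕ}
    (h : KD S I (n + 1)) (x : A) : KD S (bdry I x) n := by
  intro c hc hS
  have hI : I ≤ c.head.asIdeal := le_trans (le_trans le_sup_left le_sup_left) hc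
  have hx : x ∈ c.head.asIdeal :=
    hc (Ideal.mem_sup_left (Ideal.mem_sup_right (Ideal.mem_span_singleton_self x)))
  let M : Submonoid A := Submonoid.powers x ⊔ c.head.asIdeal.primeCompl
  have hd : Disjoint (I : Set A) M := by
    rw [Set.disjoint_left]
    intro z hzI hzM
    obtain ⟨u, ⟨j, rfl⟩, y, hy, rfl⟩ := Submonoid.mem_sup.1 hzM
    apply hy
    apply hc
    apply Ideal.mem_sup_right
    rw [Submodule.mem_comap]
    change x * y ∈ I.radical
    refine ⟨j + 1, ?_⟩
    have : (x * y) ^ (j + 1) = (x * y ^ j) * (x ^ j * y) := by ring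
    rw [this]
    exact I.mul_mem_left _ hzI
  obtain ⟨p, hp, hIp, hpM⟩ := Ideal.exists_le_prime_disjoint I M hd
  have hlt : (⟨p, hp⟩ : PrimeSpectrum A) < c.head := by
    refine lt_of_le_of_ne ?_ ?_
    · intro z hz
      by_contra hzc
      exact Set.disjoint_left.1 hpM hz (Submonoid.mem_sup_right (show z ∈ c.head.asIdeal.primeCompl from hzc))
    · intro he
      have : x ∈ p := by
        have : p = c.head.asIdeal := congrArg PrimeSpectrum.asIdeal he
        rw [this]; exact hx
      exact Set.disjoint_left.1 hpM this (Submonoid.mem_sup_left ⟨1, pow_one x⟩)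
  have := h (c.cons ⟨p, hp⟩ hlt) (by simpa using hIp) (by simpa using hS)
  simp at this
  omega

lemma KD.mono {A : Type*} [CommRing A] {S : Submonoid A} {I : Ideal A} {n m : ℕ}
    (h : KD S I n) (hnm : n ≤ m) : KD S I m := fun c h1 h2 => (h c h1 h2).trans_le hnm

theorem kronecker {A : Type*} [CommRing A] (S : Submonoid A) (n : ℕ) :
    ∀ (I : Ideal A), KD S I n → ∀ (x : Fin n → A) (b : A), ∃ y : Fin n → A, ∃ m : ℕ, ∃ σ ∈ S,
      b ^ m * σ ∈ I ⊔ Ideal.span (Set.range fun i => x i + b * y i) := by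
  induction n with
  | zero =>
    intro I h x b
    have : ¬ Disjoint (I : Set A) S := by
      intro hd
      obtain ⟨p, hp, hIp, hpM⟩ := Ideal.exists_le_prime_disjoint I S hd
      have := h (RelSeries.singleton _ ⟨p, hp⟩) hIp hpM
      omega
    obtain ⟨σ, h1, h2⟩ := Set.not_disjoint_iff.1 this
    exact ⟨x, 0, σ, h2, by rw [pow_zero, one_mul]; exact Ideal.mem_sup_left h1⟩
  | succ n ih =>
    intro I h x b
    obtain ⟨y, m, σ, hσ, hm⟩ := ih _ (h.bdry (x 0)) (fun i => x i.succ) b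
    obtain ⟨u, hu, w, hw, e1⟩ := Submodule.mem_sup.1 hm
    obtain ⟨u', hu', z, hz, e2⟩ := Submodule.mem_sup.1 hu
    rw [Submodule.mem_comap] at hz
    obtain ⟨k, hk⟩ : x 0 * z ∈ I.radical := hz
    -- work with primes
    set y' : Fin (n + 1) → A := Fin.cons z y with hy'
    set J := I ⊔ Ideal.span (Set.range fun i => x i + b * y' i) with hJ
    have hIJ : I ≤ J := le_sup_left
    have h0 : x 0 + b * z ∈ J :=
      Ideal.mem_sup_right (Ideal.subset_span ⟨0, by simp [hy']⟩)
    have hw' : w ∈ J := by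
      have : Ideal.span (Set.range fun i => x (Fin.succ i) + b * y i) ≤ J := by
        rw [Ideal.span_le]
        rintro _ ⟨i, rfl⟩
        exact Ideal.mem_sup_right (Ideal.subset_span ⟨i.succ, by simp [hy']⟩)
      exact this hw
    have key : b * (b ^ m * σ) ∈ J.radical := by
      rw [Ideal.radical_eq_sInf, Ideal.mem_sInf]
      rintro q ⟨hq, hqp⟩
      have hxz : x 0 * z ∈ q := hqp.mem_of_pow_mem k (hq (hIJ hk))
      have hu'' : u' ∈ I ⊔ Ideal.span {x 0} := hu'
      obtain ⟨g, hg, g', hg', e3⟩ := Submodule.mem_sup.1 hu''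
      obtain ⟨c, rfl⟩ := Ideal.mem_span_singleton'.1 hg'
      rw [← e1, ← e2, ← e3]
      have h0q := hq h0
      have hgq := hq (hIJ hg)
      have hwq := hq hw'
      rcases hqp.mem_or_mem hxz with h1 | h1
      · have : b * z ∈ q := by simpa using q.sub_mem h0q h1
        have e : b * (g + c * x 0 + z + w) = b * g + (b * c) * x 0 + b * z + b * w := by ring
        rw [e]
        exact q.add_mem (q.add_mem (q.add_mem (q.mul_mem_left _ hgq) (q.mul_mem_left _ h1)) this)
          (q.mul_mem_left _ hwq)
      · have : x 0 ∈ q := by simpa using q.sub_mem h0q (q.mul_mem_left b h1)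
        have e : b * (g + c * x 0 + z + w) = b * g + (b * c) * x 0 + b * z + b * w := by ring
        rw [e]
        exact q.add_mem (q.add_mem (q.add_mem (q.mul_mem_left _ hgq) (q.mul_mem_left _ this))
          (q.mul_mem_left _ h1)) (q.mul_mem_left _ hwq)
    obtain ⟨N, hN⟩ := key
    refine ⟨y', (m + 1) * N, σ ^ N, S.pow_mem hσ N, ?_⟩
    have : b ^ ((m + 1) * N) * σ ^ N = (b * (b ^ m * σ)) ^ N := by ring
    rw [this]
    exact hN

/-- One Bass step. -/
lemma bass_step {A : Type*} [CommRing A] (S : Submonoid A) (I : Ideal A) (n : ℕ) (h : KD S I n)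
    {P : Type*} [AddCommGroup P] [Module A P] (a : A) (p : P)
    (e : Fin n → P) (φ : Fin n → P →ₗ[A] A) :
    ∃ q : P, ∀ Q : Ideal A, Q.IsPrime → I ≤ Q → Disjoint (Q : Set A) S →
      (∀ ψ : P →ₗ[A] A, ψ (p + a • q) ∈ Q) →
      (∀ ψ : P →ₗ[A] A, ψ p ∈ Q) ∧ a * (Matrix.of fun i j => φ i (e j)).det ∈ Q := by
  set M : Matrix (Fin n) (Fin n) A := Matrix.of fun i j => φ i (e j) with hM
  set δ := M.det with hδ
  obtain ⟨y, m, σ, hσ, hm⟩ := kronecker S n I h (fun i => φ i p) (a * δ ^ 2)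
  set q0 : P := ∑ j, (M.adjugate.mulVec y) j • e j with hq0
  have hφ : ∀ i, φ i q0 = δ * y i := by
    intro i
    have : φ i q0 = M.mulVec (M.adjugate.mulVec y) i := by
      simp [hq0, Matrix.mulVec, dotProduct, hM, mul_comm]
    rw [this, Matrix.mulVec_mulVec, Matrix.mul_adjugate]
    simp [Matrix.smul_mulVec, hδ]
  refine ⟨δ • q0, fun Q hQ hIQ hQS hψ => ?_⟩
  have had : a * δ ∈ Q := by
    have h1 : (a * δ ^ 2) ^ m * σ ∈ Q := by
      refine (sup_le hIQ ?_) hm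
      rw [Ideal.span_le]
      rintro _ ⟨i, rfl⟩
      have := hψ (φ i)
      simp only [map_add, map_smul, hφ, smul_eq_mul] at this
      have e : φ i p + a * δ ^ 2 * y i = φ i p + a * (δ * (δ * y i)) := by ring
      change φ i p + a * δ ^ 2 * y i ∈ Q
      rw [e]
      exact this
    rcases hQ.mem_or_mem h1 with h2 | h2
    · have h3 := hQ.mem_of_pow_mem _ h2
      rcases hQ.mem_or_mem h3 with h4 | h4
      · exact Q.mul_mem_right _ h4
      · exact Q.mul_mem_left _ (hQ.mem_of_pow_mem _ h4)
    · exact absurd hσ (Set.disjoint_left.1 hQS h2)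
  refine ⟨fun ψ => ?_, had⟩
  have := hψ ψ
  simp only [map_add, map_smul, smul_eq_mul] at this
  rw [← mul_assoc] at this
  simpa using Q.sub_mem this (Q.mul_mem_right (ψ q0) had)

lemma bass_list {A : Type*} [CommRing A] (S : Submonoid A) (I : Ideal A) (n : ℕ) (h : KD S I n)
    {P : Type*} [AddCommGroup P] [Module A P] (a : A)
    (L : List ((Fin n → P) × (Fin n → P →ₗ[A] A))) : ∀ p : P,
    ∃ q : P, ∀ Q : Ideal A, Q.IsPrime → I ≤ Q → Disjoint (Q : Set A) S →
      (∀ ψ : P →ₗ[A] A, ψ (p + a • q) ∈ Q) →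
      (∀ ψ : P →ₗ[A] A, ψ p ∈ Q) ∧
        ∀ l ∈ L, a * (Matrix.of fun i j => l.2 i (l.1 j)).det ∈ Q := by
  induction L with
  | nil => exact fun p => ⟨0, fun Q _ _ _ hψ => ⟨by simpa using hψ, by simp⟩⟩
  | cons l L ih =>
    intro p
    obtain ⟨q1, h1⟩ := bass_step S I n h a p l.1 l.2
    obtain ⟨q2, h2⟩ := ih (p + a • q1)
    refine ⟨q1 + q2, fun Q hQ hIQ hQS hψ => ?_⟩
    obtain ⟨h3, h4⟩ := h2 Q hQ hIQ hQS (by simpa [smul_add, add_assoc] using hψ)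
    obtain ⟨h5, h6⟩ := h1 Q hQ hIQ hQS h3
    refine ⟨h5, fun l' hl' => ?_⟩
    rcases List.mem_cons.1 hl' with rfl | h'
    · exact h6
    · exact h4 l' h'

/-- Bass theorem: relative to a list of systems with determinants generating the unit ideal. -/
theorem bass {A : Type*} [CommRing A] (S : Submonoid A) (I : Ideal A) (n : ℕ) (h : KD S I n)
    {P : Type*} [AddCommGroup P] [Module A P]
    (L : List ((Fin n → P) × (Fin n → P →ₗ[A] A)))
    (hL : ∀ Q : Ideal A, Q.IsPrime → ∃ l ∈ L, (Matrix.of fun i j => l.2 i (l.1 j)).det ∉ Q)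
    (a : A) (p : P) (c : A) (χ : P →ₗ[A] A) (hu : c * a + χ p = 1) :
    ∃ q : P, ∃ ψ : P →ₗ[A] A, ∃ σ ∈ S, ψ (p + a • q) - σ ∈ I := by
  obtain ⟨q, hq⟩ := bass_list S I n h a L p
  refine ⟨q, ?_⟩
  -- the ideal I + O(p + a q)
  let O : Ideal A := LinearMap.range (LinearMap.applyₗ (p + a • q) : (P →ₗ[A] A) →ₗ[A] A)
  have : ¬ Disjoint ((I ⊔ O : Ideal A) : Set A) S := by
    intro hd
    obtain ⟨Q, hQ, hIQ, hQS⟩ := Ideal.exists_le_prime_disjoint _ S hd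
    obtain ⟨h1, h2⟩ := hq Q hQ (le_sup_left.trans hIQ) hQS
      (fun ψ => hIQ (Ideal.mem_sup_right ⟨ψ, rfl⟩))
    obtain ⟨l, hl, hdl⟩ := hL Q hQ
    have ha : a ∈ Q := (hQ.mem_or_mem (h2 l hl)).resolve_right hdl
    apply hQ.ne_top
    rw [Ideal.eq_top_iff_one, ← hu]
    exact Q.add_mem (Q.mul_mem_left _ ha) (h1 χ)
  obtain ⟨σ, h1, h2⟩ := Set.not_disjoint_iff.1 this
  obtain ⟨i, hi, o, ⟨ψ, rfl⟩, e⟩ := Submodule.mem_sup.1 h1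
  refine ⟨ψ, σ, h2, ?_⟩
  rw [← e]
  simpa using hi


def ElStep {ι B : Type*} [DecidableEq ι] [CommRing B] (v w : ι → B) : Prop :=
  ∃ i j, ∃ c : B, i ≠ j ∧ w = Function.update v i (v i + c * v j)

def El {ι B : Type*} [DecidableEq ι] [CommRing B] (v w : ι → B) : Prop :=
  Relation.ReflTransGen ElStep v w

section El
variable {ι B : Type*} [DecidableEq ι] [CommRing B]

lemma ElStep.symm {v w : ι → B} (h : ElStep v w) : ElStep w v := by
  obtain ⟨i, j, c, hij, rfl⟩ := h
  refine ⟨i, j, -c, hij, ?_⟩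
  simp [Function.update_of_ne hij.symm]

lemma El.refl (v : ι → B) : El v v := Relation.ReflTransGen.refl

lemma El.trans {u v w : ι → B} (h : El u v) (h' : El v w) : El u w :=
  Relation.ReflTransGen.trans h h'

lemma El.symm {v w : ι → B} (h : El v w) : El w v := by
  induction h with
  | refl => exact El.refl _
  | tail _ h2 ih => exact El.trans (Relation.ReflTransGen.single h2.symm) ih

lemma El.map {B' : Type*} [CommRing B'] (f : B →+* B') {v w : ι → B} (h : El v w) :
    El (fun i => f (v i)) (fun i => f (w i)) := by
  induction h with
  | refl => exact El.refl _
  | tail _ h2 ih =>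
    refine El.trans ih (Relation.ReflTransGen.single ?_)
    obtain ⟨i, j, c, hij, rfl⟩ := h2
    refine ⟨i, j, f c, hij, ?_⟩
    funext k
    by_cases hk : k = i
    · subst hk; simp
    · simp [hk]

lemma El.one {v w : ι → B} (i j : ι) (hij : i ≠ j) (c : B) (hi : w i = v i + c * v j)
    (hk : ∀ k, k ≠ i → w k = v k) : El v w := by
  refine Relation.ReflTransGen.single ⟨i, j, c, hij, ?_⟩
  funext k
  by_cases h : k = i
  · subst h; simp [hi]
  · simp [h, hk k h]

lemma El.comb (v : ι → B) (i : ι) (s : Finset ι) (hs : i ∉ s) (c : ι → B) :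
    El v (Function.update v i (v i + ∑ j ∈ s, c j * v j)) := by
  induction s using Finset.induction_on with
  | empty => simpa using El.refl v
  | insert k s hk ih =>
    have hi : i ∉ s := fun h => hs (Finset.mem_insert_of_mem h)
    have hik : i ≠ k := fun h => hs (h ▸ Finset.mem_insert_self _ _)
    refine El.trans (ih hi) (El.one i k hik (c k) ?_ ?_)
    · rw [Finset.sum_insert hk]; simp [hik.symm]; ring
    · intro l hl; simp [hl]

lemma El.all (v : ι → B) (i : ι) (s : Finset ι) (hs : i ∉ s) (c : ι → B) :
    El v (fun j => if j ∈ s then v j + c j * v i else v j) := by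
  induction s using Finset.induction_on with
  | empty => simpa using El.refl v
  | insert k s hk ih =>
    have hi : i ∉ s := fun h => hs (Finset.mem_insert_of_mem h)
    have hik : i ≠ k := fun h => hs (h ▸ Finset.mem_insert_self _ _)
    refine El.trans (ih hi) (El.one k i hik.symm (c k) ?_ ?_)
    · simp [hk, hi]
    · intro l hl; simp [hl]

lemma El.to_e [Fintype ι] (v : ι → B) (i : ι) (s : Finset ι) (hs : i ∉ s) (c : ι → B)
    (h : ∑ j ∈ s, c j * v j = 1) : El v (Pi.single i 1) := by
  have h1 := El.comb v i s hs (fun j => (1 - v i) * c j)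
  have e : ∑ j ∈ s, (1 - v i) * c j * v j = 1 - v i := by
    simp only [mul_assoc]
    rw [← Finset.mul_sum, h, mul_one]
  rw [e] at h1
  refine El.trans h1 ?_
  have h2 := El.all (Function.update v i (v i + (1 - v i))) i (Finset.univ.erase i) (by simp)
    (fun j => - v j)
  have e2 : (fun j => if j ∈ Finset.univ.erase i then
      (Function.update v i (v i + (1 - v i))) j + - v j * (Function.update v i (v i + (1 - v i))) i
      else (Function.update v i (v i + (1 - v i))) j) = Pi.single i 1 := by
    funext j
    by_cases hj : j = i
    · subst hj; simp
    · simp [hj]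
  rw [e2] at h2
  exact h2

/-- replace three coordinates -/
def row3 (i0 i1 i2 : ι) (v : ι → B) (a b c : B) : ι → B :=
  Function.update (Function.update (Function.update v i0 a) i1 b) i2 c

variable {i0 i1 i2 : ι}

lemma row3_01 (h01 : i0 ≠ i1) (h02 : i0 ≠ i2) (h12 : i1 ≠ i2) (v : ι → B)
    (a b c x : B) : El (row3 i0 i1 i2 v a b c) (row3 i0 i1 i2 v (a + x * b) b c) := by
  refine El.one i0 i1 h01 x ?_ ?_
  · simp [row3, h01, h02, h12]
  · intro k hk; unfold row3; simp [Function.update_apply, hk]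
lemma row3_02 (h01 : i0 ≠ i1) (h02 : i0 ≠ i2) (h12 : i1 ≠ i2) (v : ι → B)
    (a b c x : B) : El (row3 i0 i1 i2 v a b c) (row3 i0 i1 i2 v (a + x * c) b c) := by
  refine El.one i0 i2 h02 x ?_ ?_
  · simp [row3, h01, h02, h12]
  · intro k hk; unfold row3; simp [Function.update_apply, hk]
lemma row3_12 (h01 : i0 ≠ i1) (h02 : i0 ≠ i2) (h12 : i1 ≠ i2) (v : ι → B)
    (a b c x : B) : El (row3 i0 i1 i2 v a b c) (row3 i0 i1 i2 v a (b + x * c) c) := by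
  refine El.one i1 i2 h12 x ?_ ?_
  · simp [row3, h12]
  · intro k hk; unfold row3; simp [Function.update_apply, hk]
lemma row3_10 (h01 : i0 ≠ i1) (h02 : i0 ≠ i2) (h12 : i1 ≠ i2) (v : ι → B)
    (a b c x : B) : El (row3 i0 i1 i2 v a b c) (row3 i0 i1 i2 v a (b + x * a) c) := by
  refine El.one i1 i0 h01.symm x ?_ ?_
  · simp [row3, h01, h02, h12]
  · intro k hk; unfold row3; simp [Function.update_apply, hk]
lemma row3_20 (h01 : i0 ≠ i1) (h02 : i0 ≠ i2) (h12 : i1 ≠ i2) (v : ι → B)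
    (a b c x : B) : El (row3 i0 i1 i2 v a b c) (row3 i0 i1 i2 v a b (c + x * a)) := by
  refine El.one i2 i0 h02.symm x ?_ ?_
  · simp [row3, h01, h02]
  · intro k hk; unfold row3; simp [Function.update_apply, hk]
lemma row3_21 (h01 : i0 ≠ i1) (h02 : i0 ≠ i2) (h12 : i1 ≠ i2) (v : ι → B)
    (a b c x : B) : El (row3 i0 i1 i2 v a b c) (row3 i0 i1 i2 v a b (c + x * b)) := by
  refine El.one i2 i1 h12.symm x ?_ ?_
  · simp [row3, h12]
  · intro k hk; unfold row3; simp [Function.update_apply, hk]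

lemma suslin_g0 (h01 : i0 ≠ i1) (h02 : i0 ≠ i2) (h12 : i1 ≠ i2) (v : ι → B)
    (a b c t k α β d : B) (hinv : t * c + k * (α * a + β * b) = t) :
    El (row3 i0 i1 i2 v a b c) (row3 i0 i1 i2 v (a + t ^ 2 * d) b (c - t * k * α * d)) := by
  have s1 := row3_01 h01 h02 h12 v a b c (t * d * k * β)
  have s2 := row3_21 h01 h02 h12 v (a + t * d * k * β * b) b c (-(d * k ^ 2 * α * β))
  set a1 := a + t * d * k * β * b with ha1
  set c1 := c + -(d * k ^ 2 * α * β) * b with hc1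
  set W := t * d * c1 + d * k * α * a1 with hW
  have s3 := row3_12 h01 h02 h12 v a1 b c1 (-(t * d))
  have s4 := row3_10 h01 h02 h12 v a1 (b + -(t * d) * c1) c1 (-(d * k * α))
  set b1 := b + -(t * d) * c1 + -(d * k * α) * a1 with hb1
  have s5 := row3_01 h01 h02 h12 v a1 b1 c1 (-t)
  have s6 := row3_21 h01 h02 h12 v (a1 + -t * b1) b1 c1 (k * α)
  set a2 := a1 + -t * b1 with ha2
  set c2 := c1 + k * α * b1 with hc2
  have s7 := row3_12 h01 h02 h12 v a2 b1 c2 (t * d)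
  have s8 := row3_10 h01 h02 h12 v a2 (b1 + t * d * c2) c2 (d * k * α)
  have e8 : b1 + t * d * c2 + d * k * α * a2 = b := by
    rw [hc2, ha2, hb1]; ring
  rw [e8] at s8
  have s9 := row3_01 h01 h02 h12 v a2 b c2 t
  have s10 := row3_21 h01 h02 h12 v (a2 + t * b) b c2 (-(k * α))
  have e1 : a2 + t * b = a + t ^ 2 * d := by
    rw [ha2, hb1, ha1, hc1]; linear_combination (t * d) * hinv
  have e2 : c2 + -(k * α) * b = c - t * k * α * d := by
    rw [hc2, hb1, ha1, hc1]; linear_combination (- k * α * d) * hinv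
  rw [e1] at s9 s10
  rw [e2] at s10
  exact s1.trans <| s2.trans <| s3.trans <| s4.trans <| s5.trans <| s6.trans <| s7.trans <|
    s8.trans <| s9.trans s10

lemma row3_swap (h01 : i0 ≠ i1) (h02 : i0 ≠ i2) (h12 : i1 ≠ i2) (v : ι → B)
    (a b c : B) : row3 i1 i0 i2 v b a c = row3 i0 i1 i2 v a b c := by
  unfold row3
  rw [Function.update_comm h01]

lemma suslin_g1 (h01 : i0 ≠ i1) (h02 : i0 ≠ i2) (h12 : i1 ≠ i2) (v : ι → B)
    (a b c t k α β d : B) (hinv : t * c + k * (α * a + β * b) = t) :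
    El (row3 i0 i1 i2 v a b c) (row3 i0 i1 i2 v a (b + t ^ 2 * d) (c - t * k * β * d)) := by
  have := suslin_g0 h01.symm h12 h02 v b a c t k β α d (by linear_combination hinv)
  rwa [row3_swap h01 h02 h12, row3_swap h01 h02 h12] at this

lemma row3_self (v : ι → B) : row3 i0 i1 i2 v (v i0) (v i1) (v i2) = v := by
  simp [row3]

lemma suslin (h01 : i0 ≠ i1) (h02 : i0 ≠ i2) (h12 : i1 ≠ i2) (v : ι → B)
    [Fintype ι] (w d : ι → B) (t α β α' β' : B) (h1 : α * v i0 + β * v i1 = t)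
    (h2 : α' * w i0 + β' * w i1 = t) (hw : ∀ i, w i = v i + t ^ 2 * d i) : El v w := by
  let s : Finset ι := Finset.univ.filter (fun j => j ≠ i0 ∧ j ≠ i1)
  have k1 := El.all v i0 s (by simp [s]) (fun j => t * d j * α)
  set u1 : ι → B := (fun j => if j ∈ s then v j + t * d j * α * v i0 else v j) with hu1
  have k2 := El.all u1 i1 s (by simp [s]) (fun j => t * d j * β)
  set u2 : ι → B := (fun j => if j ∈ s then u1 j + t * d j * β * u1 i1 else u1 j) with hu2
  have e0 : u2 i0 = v i0 := by simp [hu2, hu1, s]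
  have e1 : u2 i1 = v i1 := by simp [hu2, hu1, s]
  have ek : ∀ k, k ≠ i0 → k ≠ i1 → u2 k = w k := by
    intro k hk0 hk1
    have : k ∈ s := by simp [s, hk0, hk1]
    have h' : i1 ∉ s := by simp [s]
    simp only [hu2, hu1, this, if_true, h', if_false, hw]
    linear_combination (t * d k) * h1
  set c := u2 i2 with hc
  have k3 := suslin_g0 h01 h02 h12 u2 (u2 i0) (u2 i1) c t (1 - c) α β (d i0)
    (by rw [e0, e1, h1]; ring)
  have k4 := suslin_g1 h01 h02 h12 u2 (u2 i0 + t ^ 2 * d i0) (u2 i1) (c - t * (1 - c) * α * d i0)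
    t (1 - c) α β (d i1) (by rw [e0, e1]; linear_combination (1 - c) * h1)
  rw [row3_self] at k3
  rw [e0, ← hw, e1, ← hw] at k4
  rw [e0, ← hw, e1] at k3
  set z := (1 - c) * (α * d i0 + β * d i1)
  have k5 := row3_20 h01 h02 h12 u2 (w i0) (w i1)
    (c - t * (1 - c) * α * d i0 - t * (1 - c) * β * d i1) (z * α')
  have k6 := row3_21 h01 h02 h12 u2 (w i0) (w i1)
    (c - t * (1 - c) * α * d i0 - t * (1 - c) * β * d i1 + z * α' * w i0) (z * β')
  have e : c - t * (1 - c) * α * d i0 - t * (1 - c) * β * d i1 + z * α' * w i0 + z * β' * w i1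
      = w i2 := by
    rw [← ek i2 h02.symm h12.symm]
    linear_combination z * h2
  rw [e] at k6
  have ew : row3 i0 i1 i2 u2 (w i0) (w i1) (w i2) = w := by
    funext k
    unfold row3
    simp only [Function.update_apply]
    split_ifs with h h' h'' <;> try subst_vars <;> try rfl
    exact ek k h'' h'
  rw [ew] at k6
  exact k1.trans <| k2.trans <| k3.trans <| k4.trans <| k5.trans k6

end El


section Free
variable {D : Type*} [CommRing D]

lemma integral_quot (J : Ideal D[X]) (a : D[X]) (ha : a.Monic) (haJ : a ∈ J) :
    Algebra.IsIntegral D (D[X] ⧸ J) := by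
  constructor
  intro z
  obtain ⟨p, rfl⟩ := Ideal.Quotient.mk_surjective z
  have hx : IsIntegral D (Ideal.Quotient.mk J X) := by
    refine ⟨a, ha, ?_⟩
    have : Polynomial.eval₂ (algebraMap D (D[X] ⧸ J)) (Ideal.Quotient.mk J X) a
        = Ideal.Quotient.mk J (Polynomial.eval₂ C X a) := by
      rw [Polynomial.hom_eval₂]; rfl
    rw [this, Polynomial.eval₂_C_X]
    exact Ideal.Quotient.eq_zero_iff_mem.2 haJ
  have : Ideal.Quotient.mk J p = Polynomial.aeval (Ideal.Quotient.mk J X) p := by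
    rw [Polynomial.aeval_def]
    conv_lhs => rw [← Polynomial.eval₂_C_X (p := p), Polynomial.hom_eval₂]
    rfl
  rw [this]
  exact adjoin_le_integralClosure hx (Polynomial.aeval_mem_adjoin_singleton D _)

lemma maximal_of_monic (m : Ideal D) (hm : m.IsMaximal) (a : D[X]) (ha : a.Monic)
    (Q : Ideal D[X]) (hQ : Q.IsPrime) (haQ : a ∈ Q) (hmQ : m.map Polynomial.C ≤ Q) :
    Q.IsMaximal := by
  haveI := integral_quot Q a ha haQ
  have hc : m ≤ Q.comap Polynomial.C := Ideal.map_le_iff_le_comap.1 hmQ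
  have hc' : m = Q.comap Polynomial.C := hm.eq_of_le (Ideal.comap_ne_top _ hQ.ne_top) hc
  have : (⊥ : Ideal (D[X] ⧸ Q)).comap (algebraMap D (D[X] ⧸ Q)) = m := by
    rw [hc']
    ext x
    rw [Ideal.mem_comap, Ideal.mem_bot, Ideal.mem_comap]
    exact Ideal.Quotient.eq_zero_iff_mem
  have h2 : (⊥ : Ideal (D[X] ⧸ Q)).IsMaximal := by
    refine Ideal.isMaximal_of_isIntegral_of_isMaximal_comap (R := D) ⊥ ?_
    rw [this]; exact hm
  exact (Ideal.bot_quotient_isMaximal_iff Q).1 h2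

lemma exists_t (m : Ideal D) (hm : m.IsMaximal) (a : D[X]) (ha : a.Monic)
    (J : Ideal D[X]) (haJ : a ∈ J) (hJ : J ⊔ m.map Polynomial.C = ⊤) :
    ∃ t, t ∉ m ∧ Polynomial.C t ∈ J := by
  by_contra hcon
  push Not at hcon
  haveI := integral_quot J a ha haJ
  obtain ⟨Q, -, hQ, hQm⟩ := Ideal.exists_ideal_over_prime_of_isIntegral (R := D) (S := D[X] ⧸ J)
    m ⊥ (by
      intro x hx
      rw [Ideal.mem_comap, Ideal.mem_bot] at hx
      by_contra hxm
      exact hcon x hxm (Ideal.Quotient.eq_zero_iff_mem.1 hx))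
  have h1 : (Q.comap (Ideal.Quotient.mk J)).IsPrime := inferInstance
  apply h1.ne_top
  rw [eq_top_iff, ← hJ]
  refine sup_le ?_ ?_
  · intro x hx
    rw [Ideal.mem_comap, Ideal.Quotient.eq_zero_iff_mem.2 hx]
    exact Q.zero_mem
  · rw [Ideal.map_le_iff_le_comap]
    intro x hx
    rw [← hQm] at hx
    exact hx

/-- monic polynomials -/
def monics (D : Type*) [CommRing D] : Submonoid D[X] where
  carrier := {p | p.Monic}
  one_mem' := monic_one
  mul_mem' := fun h1 h2 => h1.mul h2

variable {ι : Type*} [DecidableEq ι]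

/-- Quillen-type ideal -/
def quil (v : ι → D[X]) : Ideal D where
  carrier := {c | ∀ g h : D[X], El (fun i => (v i).comp (g + C c * h)) (fun i => (v i).comp g)}
  zero_mem' := by intro g h; simpa using El.refl _
  add_mem' := by
    intro c c' hc hc' g h
    have h1 := hc' (g + C c * h) h
    have : g + C (c + c') * h = g + C c * h + C c' * h := by rw [C_add]; ring
    rw [this]
    exact h1.trans (hc g h)
  smul_mem' := by
    intro x c hc g h
    have : g + C (x • c) * h = g + C c * (C x * h) := by rw [smul_eq_mul, C_mul]; ring
    rw [this]
    exact hc g _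

lemma quil_of_El {v w : ι → D[X]} (h : El v w) : quil v ≤ quil w := by
  intro c hc g k
  have h1 : ∀ g : D[X], El (fun i => (v i).comp g) (fun i => (w i).comp g) :=
    fun g => h.map (Polynomial.compRingHom g)
  exact (h1 _).symm.trans ((hc g k).trans (h1 g))

lemma quil_mem [Fintype ι] {i0 i1 i2 : ι} (h01 : i0 ≠ i1) (h02 : i0 ≠ i2) (h12 : i1 ≠ i2)
    (v : ι → D[X]) (t : D) (α β : D[X]) (h : α * v i0 + β * v i1 = C t) : t ^ 2 ∈ quil v := by
  intro g k
  have hd : ∀ i, ∃ d, (v i).comp (g + C (t ^ 2) * k) - (v i).comp g = (C t) ^ 2 * d := by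
    intro i
    have := Polynomial.sub_dvd_eval_sub (g + C (t ^ 2) * k) g ((v i).map C)
    rw [Polynomial.eval_map, Polynomial.eval_map] at this
    obtain ⟨d, hd⟩ := this
    refine ⟨k * d, ?_⟩
    change Polynomial.eval₂ C _ (v i) - Polynomial.eval₂ C _ (v i) = _
    rw [hd, C_pow]; ring
  choose d hd using hd
  have hrel : ∀ g : D[X], α.comp g * (v i0).comp g + β.comp g * (v i1).comp g = C t := by
    intro g
    rw [← Polynomial.mul_comp, ← Polynomial.mul_comp, ← Polynomial.add_comp, h, Polynomial.C_comp]
  refine El.symm (suslin h01 h02 h12 _ _ d (C t) (α.comp g) (β.comp g)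
    (α.comp (g + C (t ^ 2) * k)) (β.comp (g + C (t ^ 2) * k)) (hrel _) (hrel _) ?_)
  intro i
  rw [← hd]; ring

/-- iterate Kronecker with n = 1 -/
lemma kron_iter {A : Type*} [CommRing A] (I : Ideal A) (hI : KD ⊥ I 1) (v : ι → A) (x : A)
    (s : Finset ι) : ∃ c : ι → A, ∀ Q : Ideal A, Q.IsPrime → I ≤ Q →
      x + ∑ j ∈ s, c j * v j ∈ Q → x ∈ Q ∧ ∀ j ∈ s, v j ∈ Q := by
  induction s using Finset.induction_on with
  | empty => exact ⟨0, fun Q _ _ h => ⟨by simpa using h, by simp⟩⟩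
  | insert k s hk ih =>
    obtain ⟨c, hc⟩ := ih
    obtain ⟨y, m, σ, hσ, hm⟩ := kronecker ⊥ 1 I hI (fun _ => x + ∑ j ∈ s, c j * v j) (v k)
    rw [Submonoid.mem_bot] at hσ
    subst hσ
    refine ⟨Function.update c k (y 0), fun Q hQ hIQ hx => ?_⟩
    have e : ∑ j ∈ s, (Function.update c k (y 0)) j * v j = ∑ j ∈ s, c j * v j := by
      refine Finset.sum_congr rfl fun j hj => ?_
      rw [Function.update_of_ne]
      rintro rfl; exact hk hj
    rw [Finset.sum_insert hk, e, Function.update_self] at hx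
    have h1 : v k ^ m * 1 ∈ Q := by
      refine (sup_le hIQ ?_) hm
      rw [Ideal.span_le]
      rintro _ ⟨i, rfl⟩
      change x + ∑ j ∈ s, c j * v j + v k * y i ∈ Q
      have : x + ∑ j ∈ s, c j * v j + v k * y i = x + (y 0 * v k + ∑ j ∈ s, c j * v j) := by
        rw [Subsingleton.elim i 0]; ring
      rw [this]; exact hx
    rw [mul_one] at h1
    have h2 := hQ.mem_of_pow_mem _ h1
    have h3 : x + ∑ j ∈ s, c j * v j ∈ Q := by
      have := Q.sub_mem hx (Q.mul_mem_left (y 0) h2)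
      have e : x + (y 0 * v k + ∑ j ∈ s, c j * v j) - y 0 * v k = x + ∑ j ∈ s, c j * v j := by ring
      rwa [e] at this
    obtain ⟨h4, h5⟩ := hc Q hQ hIQ h3
    refine ⟨h4, fun j hj => ?_⟩
    rcases Finset.mem_insert.1 hj with rfl | hj
    · exact h2
    · exact h5 j hj

/-- El preserves the ideal. -/
lemma El.span_le {B : Type*} [CommRing B] {v w : ι → B} (h : El v w) :
    Ideal.span (Set.range v) ≤ Ideal.span (Set.range w) := by
  have h' := h.symm
  clear h
  induction h' with
  | refl => exact le_rfl
  | tail _ h2 ih =>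
    rename_i b c _
    refine le_trans ?_ ih
    rw [Ideal.span_le]
    obtain ⟨i, j, c, hij, rfl⟩ := h2
    rintro _ ⟨k, rfl⟩
    by_cases hk : k = i
    · subst hk
      rw [Function.update_self]
      exact Ideal.add_mem _ (Ideal.subset_span ⟨k, rfl⟩)
        (Ideal.mul_mem_left _ _ (Ideal.subset_span ⟨j, rfl⟩))
    · rw [Function.update_of_ne hk]
      exact Ideal.subset_span ⟨k, rfl⟩

end Free


lemma kron_row {A : Type*} [CommRing A] (S : Submonoid A) (n : ℕ) (hS : KD S ⊥ n)
    (v : Fin (n + 1) → A) (hv : Ideal.span (Set.range v) = ⊤) :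
    ∃ w, El v w ∧ w 0 = v 0 ∧ ∃ c : Fin (n + 1) → A,
      ∑ j ∈ Finset.univ.erase 0, c j * w j ∈ S := by
  obtain ⟨y, m, σ, hσ, hm⟩ := kronecker S n ⊥ hS (fun i => v i.succ) (v 0)
  let w : Fin (n + 1) → A := fun j => if j ∈ Finset.univ.erase 0 then
    v j + (Fin.cons 0 y : Fin (n + 1) → A) j * v 0 else v j
  have hw : El v w := El.all v 0 (Finset.univ.erase 0) (by simp) (Fin.cons 0 y)
  have hw0 : w 0 = v 0 := by simp [w]
  have hws : ∀ i : Fin n, w i.succ = v i.succ + v 0 * y i := by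
    intro i; simp [w, mul_comm]
  have htop : Ideal.span (Set.range w) = ⊤ := by
    rw [eq_top_iff, ← hv]; exact hw.span_le
  rw [bot_sup_eq] at hm
  let J := Ideal.span (Set.range fun i => v (Fin.succ i) + v 0 * y i)
  have h1 : Ideal.span {v 0} ⊔ J = ⊤ := by
    rw [eq_top_iff, ← htop, Ideal.span_le]
    rintro _ ⟨j, rfl⟩
    refine Fin.cases ?_ (fun i => ?_) j
    · rw [hw0]; exact Ideal.mem_sup_left (Ideal.mem_span_singleton_self _)
    · rw [hws]; exact Ideal.mem_sup_right (Ideal.subset_span ⟨i, rfl⟩)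
  have h2 : Ideal.span {v 0 ^ m} ⊔ J = ⊤ := by
    rw [← Ideal.span_singleton_pow]
    exact Ideal.pow_sup_eq_top h1
  have h3 : σ ∈ J := by
    have : (1 : A) ∈ Ideal.span {v 0 ^ m} ⊔ J := by rw [h2]; trivial
    obtain ⟨a, ha, b, hb, e⟩ := Submodule.mem_sup.1 this
    obtain ⟨c, rfl⟩ := Ideal.mem_span_singleton'.1 ha
    have e' : σ = c * (v 0 ^ m * σ) + σ * b := by linear_combination (-σ) * e
    rw [e']
    exact J.add_mem (J.mul_mem_left _ hm) (J.mul_mem_left _ hb)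
  obtain ⟨c, hc⟩ := (Ideal.mem_span_range_iff_exists_fun).1 h3
  refine ⟨w, hw, hw0, Fin.cons 0 c, ?_⟩
  have : ∑ j ∈ Finset.univ.erase 0, (Fin.cons 0 c : Fin (n + 1) → A) j * w j = σ := by
    have h := Fin.sum_univ_succ (fun j => (Fin.cons 0 c : Fin (n + 1) → A) j * w j)
    rw [← Finset.add_sum_erase _ _ (Finset.mem_univ (0 : Fin (n+1)))] at h
    simp only [Fin.cons_zero, zero_mul, zero_add, Fin.cons_succ, hws] at h
    rw [h, ← hc]
  rw [this]; exact hσ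

lemma to_const {D : Type*} [CommRing D] {ι : Type*} [DecidableEq ι] (v : ι → D[X])
    (h : quil v = ⊤) : El v (fun i => C ((v i).eval 0)) := by
  have h1 : (1 : D) ∈ quil v := by rw [h]; trivial
  have := h1 0 X
  simpa [Polynomial.comp_zero] using this

lemma quil_top {D : Type*} [CommRing D] {ι : Type*} [DecidableEq ι] [Fintype ι]
    {i0 i1 i2 : ι} (h01 : i0 ≠ i1) (h02 : i0 ≠ i2) (h12 : i1 ≠ i2)
    (v : ι → D[X]) (hv : Ideal.span (Set.range v) = ⊤) (ha : (v i0).Monic) : quil v = ⊤ := by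
  by_contra hne
  obtain ⟨m, hm, hle⟩ := Ideal.exists_le_maximal _ hne
  let I : Ideal D[X] := Ideal.span {v i0} ⊔ m.map C
  have hKD : KD ⊥ I 1 := by
    intro c hc _
    by_contra hlen
    push Not at hlen
    have h1 : c.head < c ⟨1, by omega⟩ := c.strictMono (by simp [Fin.lt_def])
    have h2 : c.head.asIdeal.IsMaximal := maximal_of_monic m hm _ ha _ c.head.isPrime
      (hc (Ideal.mem_sup_left (Ideal.mem_span_singleton_self _))) (le_sup_right.trans hc)
    have h3 : c.head.asIdeal < (c ⟨1, by omega⟩).asIdeal := h1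
    exact (c ⟨1, by omega⟩).isPrime.ne_top (h2.1.2 _ h3)
  let s : Finset ι := (Finset.univ.erase i0).erase i1
  obtain ⟨c, hc⟩ := kron_iter I hKD v (v i1) s
  have hE := El.comb v i1 s (by simp [s]) c
  set w := Function.update v i1 (v i1 + ∑ j ∈ s, c j * v j) with hw
  have hw0 : w i0 = v i0 := by simp [hw, h01]
  have hw1 : w i1 = v i1 + ∑ j ∈ s, c j * v j := by simp [hw]
  have hJ : Ideal.span {w i0, w i1} ⊔ m.map C = ⊤ := by
    by_contra hne
    obtain ⟨Q, hQ, hQle⟩ := Ideal.exists_le_maximal _ hne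
    have q0 : v i0 ∈ Q := hw0 ▸ hQle (Ideal.mem_sup_left (Ideal.subset_span (by simp)))
    have q1 : v i1 + ∑ j ∈ s, c j * v j ∈ Q :=
      hw1 ▸ hQle (Ideal.mem_sup_left (Ideal.subset_span (by simp)))
    have hI : I ≤ Q := sup_le (by rw [Ideal.span_singleton_le_iff_mem]; exact q0)
      (le_sup_right.trans hQle)
    obtain ⟨h3, h4⟩ := hc Q hQ.isPrime hI q1
    apply hQ.ne_top
    rw [eq_top_iff, ← hv, Ideal.span_le]
    rintro _ ⟨j, rfl⟩
    by_cases j0 : j = i0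
    · subst j0; exact q0
    by_cases j1 : j = i1
    · subst j1; exact h3
    · exact h4 j (by simp [s, j0, j1])
  obtain ⟨t, htm, htJ⟩ := exists_t m hm (w i0) (hw0 ▸ ha) _ (Ideal.subset_span (by simp)) hJ
  obtain ⟨α, β, e⟩ := Ideal.mem_span_pair.1 htJ
  have := quil_mem h01 h02 h12 w t α β e
  exact htm (hm.isPrime.mem_of_pow_mem 2 (hle (quil_of_El hE.symm this)))

theorem free_thm {D : Type*} [CommRing D] (n : ℕ) (h1 : KD (⊥ : Submonoid D) ⊥ (n + 2))
    (h2 : KD (monics D) ⊥ (n + 2)) (v : Fin (n + 3) → D[X])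
    (hv : Ideal.span (Set.range v) = ⊤) : El v (Pi.single 0 1) := by
  obtain ⟨w, hvw, hw0, c, hc⟩ := kron_row (monics D) (n + 2) h2 v hv
  set σ := ∑ j ∈ Finset.univ.erase 0, c j * w j with hσ
  have hσm : σ.Monic := hc
  have hE := El.comb w 0 (Finset.univ.erase 0) (by simp) (fun j => X ^ ((w 0).natDegree + 1) * c j)
  have e : ∑ j ∈ Finset.univ.erase 0, X ^ ((w 0).natDegree + 1) * c j * w j =
      X ^ ((w 0).natDegree + 1) * σ := by
    rw [hσ, Finset.mul_sum]; simp only [mul_assoc]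
  rw [e] at hE
  set u := Function.update w 0 (w 0 + X ^ ((w 0).natDegree + 1) * σ) with hu
  have hvu := hvw.trans hE
  have hutop : Ideal.span (Set.range u) = ⊤ := by
    rw [eq_top_iff, ← hv]; exact hvu.span_le
  rcases subsingleton_or_nontrivial D with hs | hs
  · have : v = Pi.single 0 1 := Subsingleton.elim _ _
    rw [this]; exact El.refl _
  have hum : (u 0).Monic := by
    rw [hu, Function.update_self]
    refine Polynomial.Monic.add_of_right ((monic_X_pow _).mul hσm) ?_
    rw [hσm.degree_mul, degree_X_pow]
    refine lt_of_le_of_lt Polynomial.degree_le_natDegree ?_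
    rw [Polynomial.degree_eq_natDegree hσm.ne_zero]
    norm_cast
    omega
  have hq : quil u = ⊤ := quil_top (i0 := 0) (i1 := ⟨1, by omega⟩) (i2 := ⟨2, by omega⟩)
    (by simp [Fin.ext_iff])
    (by simp [Fin.ext_iff]) (by simp [Fin.ext_iff]) u hutop hum
  have h3 := to_const u hq
  have h4 : Ideal.span (Set.range fun i => (u i).eval 0) = ⊤ := by
    have := congrArg (Ideal.map (Polynomial.evalRingHom (0 : D))) hutop
    rw [Ideal.map_span, Ideal.map_top, ← Set.range_comp] at this
    exact this
  obtain ⟨z, hz, -, c', hc'⟩ := kron_row ⊥ (n + 2) h1 _ h4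
  rw [Submonoid.mem_bot] at hc'
  have h5 := (hz.trans (El.to_e z 0 _ (by simp) c' hc')).map (C : D →+* D[X])
  have e5 : (fun i => C ((Pi.single 0 1 : Fin (n + 3) → D) i)) =
      (Pi.single 0 1 : Fin (n + 3) → D[X]) := by
    funext i
    by_cases hi : i = 0
    · subst hi; simp
    · simp [hi]
  rw [e5] at h5
  exact hvu.trans (h3.trans h5)


lemma fiber_domain {D : Type*} [CommRing D] [IsDomain D] (P0 P1 : Ideal D[X]) (h0 : P0.IsPrime)
    (h1 : P1.IsPrime) (hlt : P0 < P1) (hc : P1.comap (C : D →+* D[X]) = ⊥) : P0 = ⊥ := by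
  by_contra hne
  let K := FractionRing D
  letI : Algebra D[X] K[X] := (Polynomial.mapRingHom (algebraMap D K)).toAlgebra
  let M := Submonoid.map (C : D →+* D[X]) (nonZeroDivisors D)
  haveI : IsLocalization M K[X] := Polynomial.isLocalization (nonZeroDivisors D) K
  have hd1 : Disjoint (M : Set D[X]) P1 := by
    rw [Set.disjoint_left]
    rintro _ ⟨x, hx, rfl⟩ hx'
    have : x ∈ P1.comap (C : D →+* D[X]) := hx'
    rw [hc, Ideal.mem_bot] at this
    subst this
    exact zero_notMem_nonZeroDivisors hx
  have hd0 : Disjoint (M : Set D[X]) P0 := hd1.mono_right hlt.le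
  have e0 := IsLocalization.under_map_of_isPrime_disjoint M K[X] h0 hd0
  have e1 := IsLocalization.under_map_of_isPrime_disjoint M K[X] h1 hd1
  have p0 := IsLocalization.isPrime_of_isPrime_disjoint M K[X] P0 h0 hd0
  have p1 := IsLocalization.isPrime_of_isPrime_disjoint M K[X] P1 h1 hd1
  have hne' : P0.map (algebraMap D[X] K[X]) ≠ ⊥ := by
    intro h
    apply hne
    rw [h] at e0
    rw [← e0, eq_bot_iff]
    intro x hx
    have hx' : algebraMap D[X] K[X] x = 0 := hx
    have : Function.Injective (Polynomial.mapRingHom (algebraMap D K)) :=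
      Polynomial.map_injective _ (IsFractionRing.injective D K)
    exact this (by rw [map_zero]; exact hx')
  have hmax := p0.isMaximal hne'
  have := hmax.eq_of_le p1.ne_top (Ideal.map_mono hlt.le)
  rw [this, e1] at e0
  exact hlt.ne e0.symm

lemma fiber {R : Type*} [CommRing R] (Q0 Q1 : Ideal R[X]) (h0 : Q0.IsPrime)
    (h1 : Q1.IsPrime) (hlt : Q0 < Q1)
    (hc : Q1.comap (C : R →+* R[X]) = Q0.comap (C : R →+* R[X])) :
    Q0 = (Q0.comap (C : R →+* R[X])).map C := by
  set q := Q0.comap (C : R →+* R[X]) with hq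
  haveI : q.IsPrime := Ideal.comap_isPrime _ _
  let φ := Polynomial.mapRingHom (Ideal.Quotient.mk q)
  have hφ : Function.Surjective φ := Polynomial.map_surjective _ Ideal.Quotient.mk_surjective
  have hker : RingHom.ker φ = q.map C := by rw [Polynomial.ker_mapRingHom, Ideal.mk_ker]
  have hle0 : q.map C ≤ Q0 := Ideal.map_comap_le
  have hle1 : q.map C ≤ Q1 := hle0.trans hlt.le
  have c0 : (Q0.map φ).comap φ = Q0 := by
    rw [Ideal.comap_map_of_surjective' φ hφ, hker, sup_eq_left]; exact hle0
  have c1 : (Q1.map φ).comap φ = Q1 := by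
    rw [Ideal.comap_map_of_surjective' φ hφ, hker, sup_eq_left]; exact hle1
  have hb := fiber_domain (Q0.map φ) (Q1.map φ)
    (Ideal.map_isPrime_of_surjective hφ (by rw [hker]; exact hle0))
    (Ideal.map_isPrime_of_surjective hφ (by rw [hker]; exact hle1))
    (lt_of_le_of_ne (Ideal.map_mono hlt.le) (fun h => by rw [h, c1] at c0; exact hlt.ne c0.symm))
    (by
      rw [eq_bot_iff]
      intro x hx
      obtain ⟨y, rfl⟩ := Ideal.Quotient.mk_surjective x
      have : C y ∈ (Q1.map φ).comap φ := by
        rw [Ideal.mem_comap] at hx ⊢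
        simpa [φ] using hx
      rw [c1] at this
      have : y ∈ Q1.comap (C : R →+* R[X]) := this
      rw [hc] at this
      exact Ideal.Quotient.eq_zero_iff_mem.2 this)
  rw [hb] at c0
  rw [← hker]
  exact c0.symm

/-- extended prime -/
noncomputable def extP {R : Type*} [CommRing R] (Q : PrimeSpectrum R) : PrimeSpectrum R[X] :=
  ⟨Q.asIdeal.map C, Ideal.isPrime_map_C_of_isPrime⟩

lemma extP_comap {R : Type*} [CommRing R] (q : Ideal R) : (q.map C).comap (C : R →+* R[X]) = q := by
  ext x
  rw [Ideal.mem_comap, Ideal.mem_map_C_iff]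
  constructor
  · intro h; simpa using h 0
  · intro h n
    rw [coeff_C]; split_ifs
    · exact h
    · exact q.zero_mem

lemma extP_lt {R : Type*} [CommRing R] {p q : PrimeSpectrum R} (h : p < q) : extP p < extP q := by
  refine lt_of_le_of_ne (Ideal.map_mono (le_of_lt h)) ?_
  intro e
  have e' : p.asIdeal.map (C : R →+* R[X]) = q.asIdeal.map C := congrArg PrimeSpectrum.asIdeal e
  have := congrArg (Ideal.comap (C : R →+* R[X])) e'
  rw [extP_comap, extP_comap] at this
  exact h.ne (PrimeSpectrum.ext this)

/-- contraction -/
noncomputable def conP {R : Type*} [CommRing R] (Q : PrimeSpectrum R[X]) : PrimeSpectrum R :=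
  PrimeSpectrum.comap C Q

lemma ext_con_le {R : Type*} [CommRing R] (Q : PrimeSpectrum R[X]) : extP (conP Q) ≤ Q :=
  Ideal.map_comap_le

lemma fiberP {R : Type*} [CommRing R] {Q0 Q1 : PrimeSpectrum R[X]} (h : Q0 < Q1)
    (hc : conP Q0 = conP Q1) : Q0 = extP (conP Q0) :=
  PrimeSpectrum.ext (fiber Q0.asIdeal Q1.asIdeal Q0.isPrime Q1.isPrime h
    (congrArg PrimeSpectrum.asIdeal hc).symm)

lemma special_chain {R : Type*} [CommRing R] (k : ℕ) : ∀ c : LTSeries (PrimeSpectrum R[X]),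
    c.length = k + 1 → c.last ≠ extP (conP c.last) →
    ∃ c' : LTSeries (PrimeSpectrum R[X]), k ≤ c'.length ∧ c'.last = extP (conP c.last) := by
  induction k with
  | zero => exact fun c _ _ => ⟨RelSeries.singleton _ (extP (conP c.last)), by simp, rfl⟩
  | succ k ih =>
    intro c hc hne
    set e : LTSeries (PrimeSpectrum R[X]) := RelSeries.eraseLast c with he
    have hlen : e.length = k + 1 := by rw [he, RelSeries.eraseLast_length]; omega
    have hlt : e.last < c.last := RelSeries.eraseLast_last_rel_last c (by omega)
    by_cases h1 : conP e.last = conP c.last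
    · refine ⟨e, hlen.ge, ?_⟩
      rw [← h1]; exact fiberP hlt h1
    have h2 : conP e.last < conP c.last :=
      lt_of_le_of_ne (Ideal.comap_mono (le_of_lt hlt)) h1
    have h3 := extP_lt h2
    by_cases h4 : e.last = extP (conP e.last)
    · refine ⟨RelSeries.snoc e (extP (conP c.last)) (show e.last < _ from h4 ▸ h3), ?_, ?_⟩
      · simp; omega
      · simp
    · obtain ⟨c', h5, h6⟩ := ih e hlen h4
      refine ⟨RelSeries.snoc c' (extP (conP c.last)) (show c'.last < _ from h6 ▸ h3), ?_, ?_⟩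
      · simp; omega
      · simp

/-- the prime (q, X) -/
noncomputable def qX {R : Type*} [CommRing R] (q : PrimeSpectrum R) : PrimeSpectrum R[X] :=
  PrimeSpectrum.comap (Polynomial.evalRingHom 0) q

lemma ext_lt_qX {R : Type*} [CommRing R] (q : PrimeSpectrum R) : extP q < qX q := by
  refine lt_of_le_of_ne ?_ ?_
  · change q.asIdeal.map C ≤ q.asIdeal.comap _
    rw [Ideal.map_le_iff_le_comap]
    intro x hx
    simpa using hx
  · intro e
    have h : (X : R[X]) ∈ (qX q).asIdeal := by
      change Polynomial.evalRingHom 0 X ∈ q.asIdeal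
      simp
    rw [← e] at h
    have := Ideal.mem_map_C_iff.1 h 1
    rw [coeff_X_one] at this
    exact q.isPrime.ne_top ((Ideal.eq_top_iff_one _).2 this)

lemma monic_of_upper {R : Type*} [CommRing R] (Q : PrimeSpectrum R[X])
    (hne : Q ≠ extP (conP Q)) (hmax : (conP Q).asIdeal.IsMaximal) :
    ∃ g ∈ Q.asIdeal, g.Monic := by
  set q := (conP Q).asIdeal with hq
  have hle : q.map C ≤ Q.asIdeal := ext_con_le Q
  obtain ⟨f, hf, hfq⟩ : ∃ f ∈ Q.asIdeal, f ∉ q.map C := by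
    by_contra hcon
    push Not at hcon
    exact hne (PrimeSpectrum.ext (le_antisymm hcon hle))
  letI := Ideal.Quotient.field q
  have hker : RingHom.ker (Polynomial.mapRingHom (Ideal.Quotient.mk q)) = q.map C := by
    rw [Polynomial.ker_mapRingHom, Ideal.mk_ker]
  set F := f.map (Ideal.Quotient.mk q) with hF
  have hF0 : F ≠ 0 := by
    intro h
    apply hfq
    rw [← hker]; exact h
  obtain ⟨u, hu⟩ := Ideal.Quotient.mk_surjective (F.leadingCoeff⁻¹)
  have hmon : (F * C F.leadingCoeff⁻¹).Monic := monic_mul_leadingCoeff_inv hF0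
  obtain ⟨g, hg, -, hgm⟩ := Polynomial.lifts_and_natDegree_eq_and_monic
    (f := Ideal.Quotient.mk q) (p := F * C F.leadingCoeff⁻¹)
    (by rw [Polynomial.lifts_iff_coeff_lifts]; exact fun n => Ideal.Quotient.mk_surjective _) hmon
  refine ⟨g, ?_, hgm⟩
  have : g - f * C u ∈ RingHom.ker (Polynomial.mapRingHom (Ideal.Quotient.mk q)) := by
    rw [RingHom.mem_ker, map_sub, map_mul]
    simp only [Polynomial.coe_mapRingHom, hg, Polynomial.map_C, hu]
    rw [hF, sub_self]
  rw [hker] at this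
  have h2 := Q.asIdeal.add_mem (hle this) (Q.asIdeal.mul_mem_right (C u) hf)
  simpa using h2

lemma KD_monics {R : Type*} [CommRing R] (N : ℕ)
    (hN : ∀ c : LTSeries (PrimeSpectrum R[X]), c.length ≤ N) : KD (monics R) ⊥ N := by
  intro c _ hd
  by_cases h : c.last = extP (conP c.last)
  · have := hN (RelSeries.snoc c (qX (conP c.last)) (show c.last < _ from by
      conv_lhs => rw [h]
      exact ext_lt_qX _))
    simpa using this
  · rcases Nat.eq_zero_or_pos c.length with h0 | h0
    · have := hN (RelSeries.snoc (RelSeries.singleton _ (extP (conP c.last))) (qX (conP c.last))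
        (ext_lt_qX _))
      rw [h0]
      exact lt_of_lt_of_le (Nat.succ_pos _) this
    · obtain ⟨c', h1, h2⟩ := special_chain (c.length - 1) c (by omega) h
      have hnm : ¬ (conP c.last).asIdeal.IsMaximal := by
        intro hm
        obtain ⟨g, hg, hgm⟩ := monic_of_upper _ h hm
        exact Set.disjoint_left.1 hd hg hgm
      obtain ⟨m, hm, hle⟩ := Ideal.exists_le_maximal _ (conP c.last).isPrime.ne_top
      let m' : PrimeSpectrum R := ⟨m, hm.isPrime⟩
      have hlt : conP c.last < m' := by
        refine lt_of_le_of_ne hle ?_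
        intro e
        apply hnm
        rw [e]; exact hm
      have := hN (RelSeries.snoc (RelSeries.snoc c' (extP m') (show c'.last < _ from
        h2 ▸ extP_lt hlt)) (qX m') (by
          rw [RelSeries.last_snoc]; exact ext_lt_qX m'))
      simp at this
      omega

lemma KD.of_surj {B B' : Type*} [CommRing B] [CommRing B'] (φ : B →+* B')
    (hφ : Function.Surjective φ) (S : Submonoid B) (S' : Submonoid B') (n : ℕ)
    (hS : ∀ x ∈ S', ∃ y ∈ S, φ y = x) (h : KD S' ⊥ n) : KD S (RingHom.ker φ) n := by
  intro c hc hd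
  have hle : ∀ i, RingHom.ker φ ≤ (c i).asIdeal := fun i =>
    hc.trans (c.monotone (Fin.zero_le i))
  have hcm : ∀ i, ((c i).asIdeal.map φ).comap φ = (c i).asIdeal := fun i => by
    rw [Ideal.comap_map_of_surjective' φ hφ, sup_eq_left]; exact hle i
  let F : Fin (c.length + 1) → PrimeSpectrum B' := fun i =>
    ⟨(c i).asIdeal.map φ, Ideal.map_isPrime_of_surjective hφ (hle i)⟩
  have hF : StrictMono F := by
    intro i j hij
    have hlt : (c i).asIdeal < (c j).asIdeal := c.strictMono hij
    refine lt_of_le_of_ne (Ideal.map_mono hlt.le) ?_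
    intro e
    have e' : (c i).asIdeal.map φ = (c j).asIdeal.map φ := congrArg PrimeSpectrum.asIdeal e
    have := hcm i
    rw [e', hcm j] at this
    exact hlt.ne this.symm
  refine h (LTSeries.mk c.length F hF) bot_le ?_
  rw [Set.disjoint_left]
  intro x hx hxS
  obtain ⟨y, hy, rfl⟩ := hS x hxS
  have : y ∈ (c.last.asIdeal.map φ).comap φ := hx
  have e := hcm (Fin.last _)
  change (c.last.asIdeal.map φ).comap φ = c.last.asIdeal at e
  rw [e] at this
  exact Set.disjoint_left.1 hd this hy

lemma KD.two {B B' : Type*} [CommRing B] [CommRing B'] (φ ψ : B →+* B')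
    (hφ : Function.Surjective φ) (hψ : Function.Surjective ψ) (S : Submonoid B)
    (S' : Submonoid B') (n : ℕ)
    (hS : ∀ x ∈ S', ∃ y ∈ S, φ y = x) (hS' : ∀ x ∈ S', ∃ y ∈ S, ψ y = x) (h : KD S' ⊥ n)
    (a b : B) (hab : a * b = 0) (ha : RingHom.ker φ ≤ Ideal.span {a})
    (hb : RingHom.ker ψ ≤ Ideal.span {b}) : KD S ⊥ n := by
  intro c _ hd
  have : a * b ∈ c.head.asIdeal := by rw [hab]; exact Ideal.zero_mem _
  rcases c.head.isPrime.mem_or_mem this with h1 | h1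
  · exact KD.of_surj φ hφ S S' n hS h c
      (ha.trans (by rw [Ideal.span_singleton_le_iff_mem]; exact h1)) hd
  · exact KD.of_surj ψ hψ S S' n hS' h c
      (hb.trans (by rw [Ideal.span_singleton_le_iff_mem]; exact h1)) hd


/-- the double of `R` along the ideal generated by `s` -/
def Rp {R : Type*} [CommRing R] (s : R) : Subring (R × R) where
  carrier := {x | s ∣ x.1 - x.2}
  mul_mem' := by
    rintro ⟨a, b⟩ ⟨c, d⟩ ⟨x, hx⟩ ⟨y, hy⟩
    simp only at hx hy
    exact ⟨x * c + b * y, by simp only [Prod.mk_mul_mk]; linear_combination c * hx + b * hy⟩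
  one_mem' := by simp
  add_mem' := by
    rintro ⟨a, b⟩ ⟨c, d⟩ ⟨x, hx⟩ ⟨y, hy⟩
    simp only at hx hy
    exact ⟨x + y, by simp only [Prod.mk_add_mk]; linear_combination hx + hy⟩
  zero_mem' := by simp
  neg_mem' := by
    rintro ⟨a, b⟩ ⟨x, hx⟩
    simp only at hx
    exact ⟨-x, by simp only [Prod.neg_mk]; linear_combination -hx⟩

section Rp
variable {R : Type*} [CommRing R] (s : R)

def rp1 : Rp s →+* R := (RingHom.fst R R).comp (Rp s).subtype
def rp2 : Rp s →+* R := (RingHom.snd R R).comp (Rp s).subtype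

def rpDiag : R →+* Rp s :=
  ((RingHom.id R).prod (RingHom.id R)).codRestrict (Rp s) (fun x => by
    change s ∣ x - x; simp)

lemma rp1_diag (x : R) : rp1 s (rpDiag s x) = x := rfl
lemma rp2_diag (x : R) : rp2 s (rpDiag s x) = x := rfl

def rpA : Rp s := ⟨(0, s), ⟨-1, by simp⟩⟩
def rpB : Rp s := ⟨(s, 0), ⟨1, by simp⟩⟩

lemma rpAB : rpA s * rpB s = 0 := by
  apply Subtype.ext
  simp [rpA, rpB]

lemma rp1_surj : Function.Surjective (rp1 s) := fun x => ⟨rpDiag s x, rfl⟩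
lemma rp2_surj : Function.Surjective (rp2 s) := fun x => ⟨rpDiag s x, rfl⟩

lemma rp1_ker : RingHom.ker (rp1 s) ≤ Ideal.span {rpA s} := by
  rintro ⟨⟨x, y⟩, ⟨z, hz⟩⟩ h
  have h : x = 0 := h
  subst h
  simp only at hz
  rw [Ideal.mem_span_singleton']
  refine ⟨rpDiag s (-z), Subtype.ext (Prod.ext ?_ ?_)⟩
  · change -z * 0 = 0; ring
  · change -z * s = y; linear_combination hz

lemma rp2_ker : RingHom.ker (rp2 s) ≤ Ideal.span {rpB s} := by
  rintro ⟨⟨x, y⟩, ⟨z, hz⟩⟩ h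
  have h : y = 0 := h
  subst h
  simp only at hz
  rw [Ideal.mem_span_singleton']
  refine ⟨rpDiag s z, Subtype.ext (Prod.ext ?_ ?_)⟩
  · change z * s = x; linear_combination -hz
  · change z * 0 = 0; ring

lemma KD_Rp (n : ℕ) (h : KD (⊥ : Submonoid R) ⊥ n) : KD (⊥ : Submonoid (Rp s)) ⊥ n := by
  refine KD.two (rp1 s) (rp2 s) (rp1_surj s) (rp2_surj s) ⊥ ⊥ n ?_ ?_ h (rpA s) (rpB s) (rpAB s)
    (rp1_ker s) (rp2_ker s)
  · intro x hx; rw [Submonoid.mem_bot] at hx; subst hx; exact ⟨1, Submonoid.one_mem _, map_one _⟩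
  · intro x hx; rw [Submonoid.mem_bot] at hx; subst hx; exact ⟨1, Submonoid.one_mem _, map_one _⟩

lemma KD_Rp_monics (n : ℕ) (h : KD (monics R) ⊥ n) : KD (monics (Rp s)) ⊥ n := by
  refine KD.two (mapRingHom (rp1 s)) (mapRingHom (rp2 s)) (Polynomial.map_surjective _ (rp1_surj s))
    (Polynomial.map_surjective _ (rp2_surj s)) (monics (Rp s)) (monics R) n ?_ ?_ h (C (rpA s))
    (C (rpB s)) (by rw [← C_mul, rpAB, C_0]) ?_ ?_
  · intro x hx
    refine ⟨x.map (rpDiag s), hx.map _, ?_⟩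
    rw [coe_mapRingHom, Polynomial.map_map]
    exact Polynomial.map_id
  · intro x hx
    refine ⟨x.map (rpDiag s), hx.map _, ?_⟩
    rw [coe_mapRingHom, Polynomial.map_map]
    exact Polynomial.map_id
  · rw [Polynomial.ker_mapRingHom]
    refine (Ideal.map_mono (rp1_ker s)).trans ?_
    rw [Ideal.map_span, Set.image_singleton]
  · rw [Polynomial.ker_mapRingHom]
    refine (Ideal.map_mono (rp2_ker s)).trans ?_
    rw [Ideal.map_span, Set.image_singleton]
end Rp

lemma chain_le {A : Type*} [CommRing A] (n : ℕ) (h : ringKrullDim A = n)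
    (c : LTSeries (PrimeSpectrum A)) : c.length ≤ n := by
  have h1 : (c.length : WithBot ℕ∞) ≤ ringKrullDim A := Order.LTSeries.length_le_krullDim c
  rw [h] at h1
  exact_mod_cast h1

/-- contraction of a chain along a localization -/
noncomputable def conChain {B A : Type*} [CommRing B] [CommRing A] [Algebra B A] (M : Submonoid B)
    [IsLocalization M A] (c : LTSeries (PrimeSpectrum A)) : LTSeries (PrimeSpectrum B) :=
  LTSeries.map c (PrimeSpectrum.comap (algebraMap B A)) (by
    intro x y hxy
    exact lt_of_le_of_ne (Ideal.comap_mono (le_of_lt hxy))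
      (fun e => hxy.ne (PrimeSpectrum.localization_comap_injective A M e)))

lemma KD_loc_s {B A : Type*} [CommRing B] [IsDomain B] [CommRing A] [Algebra B A] (M : Submonoid B)
    [IsLocalization M A] (n : ℕ) (h : ∀ c : LTSeries (PrimeSpectrum B), c.length ≤ n) (s : B)
    (hs : s ≠ 0) (N : ℕ) : KD (⊥ : Submonoid A) (Ideal.span {algebraMap B A s ^ N}) n := by
  intro c hc _
  have h1 : algebraMap B A s ∈ c.head.asIdeal :=
    c.head.isPrime.mem_of_pow_mem N (hc (Ideal.mem_span_singleton_self _))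
  have := h (RelSeries.cons (conChain M c) ⟨⊥, Ideal.isPrime_bot⟩ (by
    refine lt_of_le_of_ne (show (⊥ : Ideal B) ≤ _ from bot_le) ?_
    intro e
    have h2 : s ∈ (conChain M c).head.asIdeal := h1
    rw [← e] at h2
    exact hs h2))
  exact (by simpa using this : (conChain M c).length < n)

/-- the multiplicative set `1 + fB` -/
def onePlus {B : Type*} [CommRing B] (f : B) : Submonoid B where
  carrier := {x | ∃ g, x = 1 + f * g}
  one_mem' := ⟨0, by simp⟩
  mul_mem' := by
    rintro _ _ ⟨g, rfl⟩ ⟨h, rfl⟩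
    exact ⟨g + h + f * g * h, by ring⟩

lemma KD_loc_f {B A : Type*} [CommRing B] [CommRing A] [Algebra B A] (f : B)
    [IsLocalization.Away f A] (n : ℕ) (h : ∀ c : LTSeries (PrimeSpectrum B), c.length ≤ n) :
    KD ((onePlus f).map (algebraMap B A)) ⊥ n := by
  intro c _ hd
  set c' : LTSeries (PrimeSpectrum B) := conChain (Submonoid.powers f) c with hc'
  have hlast : c'.last.asIdeal = c.last.asIdeal.comap (algebraMap B A) := rfl
  have hne : c'.last.asIdeal ⊔ Ideal.span {f} ≠ ⊤ := by
    intro htop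
    have : (1 : B) ∈ c'.last.asIdeal ⊔ Ideal.span {f} := by rw [htop]; trivial
    obtain ⟨a, ha, b, hb, e⟩ := Submodule.mem_sup.1 this
    obtain ⟨g, rfl⟩ := Ideal.mem_span_singleton'.1 hb
    rw [hlast, Ideal.mem_comap] at ha
    refine Set.disjoint_left.1 hd ha ⟨a, ⟨-g, by linear_combination e⟩, rfl⟩
  obtain ⟨m, hm, hle⟩ := Ideal.exists_le_maximal _ hne
  have hf : f ∉ c'.last.asIdeal := by
    intro hf
    rw [hlast, Ideal.mem_comap] at hf
    exact c.last.isPrime.ne_top (Ideal.eq_top_of_isUnit_mem _ hf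
      (IsLocalization.Away.algebraMap_isUnit f))
  have := h (RelSeries.snoc c' ⟨m, hm.isPrime⟩ (by
    refine lt_of_le_of_ne (le_sup_left.trans hle) ?_
    intro e
    apply hf
    rw [e]
    exact hle (Ideal.mem_sup_right (Ideal.mem_span_singleton_self _))))
  exact (by simpa using this : c'.length < n)

section PDsec
open Polynomial Matrix

section Exc
variable {ι B : Type*} [DecidableEq ι] [Fintype ι] [CommRing B]

/-- `1 + x ω` -/
def tv (x ω : ι → B) : Matrix ι ι B := 1 + vecMulVec x ω

lemma tv_mul (x y ω ω' : ι → B) : tv x ω * tv y ω' =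
    1 + vecMulVec x ω + vecMulVec y ω' + (ω ⬝ᵥ y) • vecMulVec x ω' := by
  unfold tv
  rw [mul_add, mul_one, add_mul, one_mul, vecMulVec_mul_vecMulVec,
    vecMulVec_smul]
  abel

lemma tv_mul_left (x y ω : ι → B) (h : ω ⬝ᵥ y = 0) : tv x ω * tv y ω = tv (x + y) ω := by
  rw [tv_mul, h, zero_smul, add_zero, tv, add_vecMulVec, add_assoc]

lemma tv_mul_right (x ω ω' : ι → B) (h : ω ⬝ᵥ x = 0) : tv x ω * tv x ω' = tv x (ω + ω') := by
  rw [tv_mul, h, zero_smul, add_zero, tv, vecMulVec_add, add_assoc]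

lemma tv_comm (x ω : ι → B) (j : ι) (hx : x j = 0) (hω : ω j = 0) (h : ω ⬝ᵥ x = 0) :
    tv x ω = tv x (Pi.single j 1) * tv (Pi.single j 1) ω * (tv (-x) (Pi.single j 1) *
      tv (Pi.single j 1) (-ω)) := by
  have h1 : vecMulVec x (Pi.single j 1) * vecMulVec x (Pi.single j 1) = 0 := by
    rw [vecMulVec_mul_vecMulVec]; simp [hx]
  have h2 : vecMulVec (Pi.single j 1) ω * vecMulVec (Pi.single j 1) ω = 0 := by
    rw [vecMulVec_mul_vecMulVec]; simp [hω]
  have h3 : vecMulVec (Pi.single j 1) ω * vecMulVec x (Pi.single j 1) = 0 := by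
    rw [vecMulVec_mul_vecMulVec]; simp [h]
  have h4 : vecMulVec x (Pi.single j 1) * vecMulVec (Pi.single j 1) ω = vecMulVec x ω := by
    rw [vecMulVec_mul_vecMulVec]; simp
  unfold tv
  rw [neg_vecMulVec, vecMulVec_neg, ← h4]
  set X := vecMulVec x (Pi.single j 1)
  set Y := vecMulVec (Pi.single j 1) ω
  have e : (1 + X) * (1 + Y) * ((1 + -X) * (1 + -Y)) = 1 + X * Y
      - X * X * (1 - Y) - (1 + X) * (Y * X) * (1 - Y) - (1 + X) * (Y * Y) := by
    noncomm_ring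
  rw [e, h1, h2, h3]
  simp

/-- elementary matrices with entries in `(s)` -/
def HE (ι : Type*) [DecidableEq ι] [Fintype ι] (s : B) : Submonoid (Matrix ι ι B) :=
  Submonoid.closure {M | ∃ i j : ι, ∃ c : B, i ≠ j ∧ M = tv (Pi.single i (s * c)) (Pi.single j 1)}

lemma tv_zero_left (ω : ι → B) : tv 0 ω = 1 := by simp [tv]
lemma tv_zero_right (x : ι → B) : tv x 0 = 1 := by simp [tv]
lemma tv_smul (c : B) (x ω : ι → B) : tv (c • x) ω = tv x (c • ω) := by
  simp [tv, smul_vecMulVec, vecMulVec_smul]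

lemma HE_sum_left {κ : Type*} (s : B) (ω : ι → B) (t : Finset κ) (x : κ → ι → B)
    (h0 : ∀ k ∈ t, ω ⬝ᵥ x k = 0) (h : ∀ k ∈ t, tv (x k) ω ∈ HE ι s) :
    tv (∑ k ∈ t, x k) ω ∈ HE ι s := by
  classical
  induction t using Finset.induction_on with
  | empty => simpa [tv_zero_left] using Submonoid.one_mem _
  | insert k t hk ih =>
    rw [Finset.sum_insert hk, ← tv_mul_left]
    · exact Submonoid.mul_mem _ (h k (by simp)) (ih (fun l hl => h0 l (by simp [hl]))
        (fun l hl => h l (by simp [hl])))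
    · rw [dotProduct_sum]
      exact Finset.sum_eq_zero fun l hl => h0 l (by simp [hl])

lemma HE_sum_right {κ : Type*} (s : B) (x : ι → B) (t : Finset κ) (ω : κ → ι → B)
    (h0 : ∀ k ∈ t, ω k ⬝ᵥ x = 0) (h : ∀ k ∈ t, tv x (ω k) ∈ HE ι s) :
    tv x (∑ k ∈ t, ω k) ∈ HE ι s := by
  classical
  induction t using Finset.induction_on with
  | empty => simpa [tv_zero_right] using Submonoid.one_mem _
  | insert k t hk ih =>
    rw [Finset.sum_insert hk, ← tv_mul_right]
    · exact Submonoid.mul_mem _ (h k (by simp)) (ih (fun l hl => h0 l (by simp [hl]))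
        (fun l hl => h l (by simp [hl])))
    · exact h0 k (by simp)

lemma sum_single_erase (x : ι → B) (j : ι) (hx : x j = 0) :
    ∑ i ∈ Finset.univ.erase j, Pi.single i (x i) = x := by
  have h := Finset.univ_sum_single x
  rw [← Finset.add_sum_erase _ _ (Finset.mem_univ j), hx, Pi.single_zero, zero_add] at h
  exact h

lemma HE_col (s : B) (x : ι → B) (j : ι) (hx : x j = 0) : tv (s • x) (Pi.single j 1) ∈ HE ι s := by
  have e : s • x = ∑ i ∈ Finset.univ.erase j, Pi.single i (s * x i) := by
    rw [sum_single_erase (fun i => s * x i) j (by simp [hx])]; rfl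
  rw [e]
  refine HE_sum_left s _ _ _ ?_ ?_
  · intro k hk
    have := Finset.ne_of_mem_erase hk
    simp [this.symm]
  · intro k hk
    exact Submonoid.subset_closure ⟨k, j, x k, Finset.ne_of_mem_erase hk, rfl⟩

lemma HE_row (s : B) (ω : ι → B) (j : ι) (hω : ω j = 0) :
    tv (Pi.single j 1) (s • ω) ∈ HE ι s := by
  have e : s • ω = ∑ i ∈ Finset.univ.erase j, Pi.single i (s * ω i) := by
    rw [sum_single_erase (fun i => s * ω i) j (by simp [hω])]; rfl
  rw [e]
  refine HE_sum_right s _ _ _ ?_ ?_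
  · intro k hk
    have := Finset.ne_of_mem_erase hk
    simp [this]
  · intro k hk
    refine Submonoid.subset_closure ⟨j, k, ω k, (Finset.ne_of_mem_erase hk).symm, ?_⟩
    have e1 : (Pi.single j (s * ω k) : ι → B) = (s * ω k) • Pi.single j 1 := by
      rw [← Pi.single_smul]; simp
    have e2 : (Pi.single k (s * ω k) : ι → B) = (s * ω k) • Pi.single k 1 := by
      rw [← Pi.single_smul]; simp
    rw [e1, e2, tv_smul]

lemma HE_comm (s c : B) (x ω : ι → B) (j : ι) (hx : x j = 0) (hω : ω j = 0) (h : ω ⬝ᵥ x = 0) :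
    tv (s • x) (s • (c • ω)) ∈ HE ι s := by
  rw [tv_comm (s • x) (s • (c • ω)) j (by simp [hx]) (by simp [hω]) (by simp [h])]
  refine Submonoid.mul_mem _ (Submonoid.mul_mem _ (HE_col s x j hx)
    (HE_row s _ j (by simp [hω]))) (Submonoid.mul_mem _ ?_ ?_)
  · rw [← smul_neg]; exact HE_col s _ j (by simp [hx])
  · rw [← smul_neg]; exact HE_row s _ j (by simp [hω])

lemma HE_V1 (h3 : ∀ k l : ι, ∃ j, j ≠ k ∧ j ≠ l) (s c : B) (u : ι → B) (k l : ι) (hkl : k ≠ l) :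
    tv (s • u) (s • (c • (Pi.single k (u l) - Pi.single l (u k)))) ∈ HE ι s := by
  set ω : ι → B := Pi.single k (u l) - Pi.single l (u k) with hω
  let x : ι → B := Pi.single k (u k) + Pi.single l (u l)
  let t : Finset ι := (Finset.univ.erase k).erase l
  have hu : u = x + ∑ i ∈ t, Pi.single i (u i) := by
    have h := Finset.univ_sum_single u
    rw [← Finset.add_sum_erase _ _ (Finset.mem_univ k),
      ← Finset.add_sum_erase (Finset.univ.erase k) _ (a := l) (by simp [hkl.symm])] at h
    rw [add_assoc]; exact h.symm
  have hωx : ω ⬝ᵥ x = 0 := by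
    simp [hω, x, sub_dotProduct, dotProduct_add, hkl, hkl.symm]
    ring
  have ht : ∀ i ∈ t, ω i = 0 := by
    intro i hi
    have h1 : i ≠ l := Finset.ne_of_mem_erase hi
    have h2 : i ≠ k := Finset.ne_of_mem_erase (Finset.mem_of_mem_erase hi)
    simp [hω, h1, h2]
  obtain ⟨j, hjk, hjl⟩ := h3 k l
  have e : s • u = s • x + ∑ i ∈ t, Pi.single i (s * u i) := by
    conv_lhs => rw [hu, smul_add, Finset.smul_sum]
    congr 1
    refine Finset.sum_congr rfl fun i _ => ?_
    rw [← Pi.single_smul]; rfl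
  rw [e, ← tv_mul_left]
  · refine Submonoid.mul_mem _ (HE_comm s c x ω j (by simp [x, hjk, hjl])
      (by simp [hω, hjk, hjl]) hωx) (HE_sum_left s _ _ _ ?_ ?_)
    · intro i hi; simp [ht i hi]
    · intro i hi
      have e1 : (Pi.single i (s * u i) : ι → B) = (s * u i) • Pi.single i 1 := by
        rw [← Pi.single_smul]; simp
      rw [e1, tv_smul]
      have e2 : (s * u i) • s • c • ω = s • ((s * u i * c) • ω) := by
        simp only [smul_smul]; congr 1; ring
      rw [e2]
      exact HE_row s _ i (by simp [ht i hi])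
  · rw [dotProduct_sum]
    exact Finset.sum_eq_zero fun i hi => by simp [ht i hi]

lemma HE_V (h3 : ∀ k l : ι, ∃ j, j ≠ k ∧ j ≠ l) (s c : B) (u u' ω : ι → B) (h0 : ω ⬝ᵥ u = 0)
    (h1 : u' ⬝ᵥ u = 1) : tv ((s ^ 2 * c) • u) ω ∈ HE ι s := by
  have hω : ω = ∑ p : ι × ι, (ω p.1 * u' p.2) • (Pi.single p.1 (u p.2) - Pi.single p.2 (u p.1)) := by
    funext m
    rw [Fintype.sum_prod_type]
    simp only [Finset.sum_apply, Pi.smul_apply, Pi.sub_apply, smul_eq_mul, mul_sub,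
      Finset.sum_sub_distrib]
    have a1 : ∑ k, ∑ l, ω k * u' l * (Pi.single k (u l) : ι → B) m = ω m * (u' ⬝ᵥ u) := by
      rw [Finset.sum_eq_single m]
      · simp [dotProduct, Finset.mul_sum, mul_assoc]
      · intro b _ hb; simp [hb.symm]
      · simp
    have a2 : ∑ k, ∑ l, ω k * u' l * (Pi.single l (u k) : ι → B) m = u' m * (ω ⬝ᵥ u) := by
      rw [dotProduct, Finset.mul_sum]
      refine Finset.sum_congr rfl fun k _ => ?_
      rw [Finset.sum_eq_single m]
      · simp; ring
      · intro b _ hb; simp [hb.symm]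
      · simp
    rw [a1, a2, h0, h1]; ring
  have e : tv ((s ^ 2 * c) • u) ω = tv (s • u) (s • c • ω) := by
    rw [tv_smul, tv_smul]; simp only [smul_smul]; congr 2; ring
  rw [e]
  have e2 : s • c • ω = ∑ p : ι × ι,
      s • ((c * (ω p.1 * u' p.2)) • (Pi.single p.1 (u p.2) - Pi.single p.2 (u p.1))) := by
    conv_lhs => rw [hω, Finset.smul_sum, Finset.smul_sum]
    simp only [smul_smul]
  rw [e2]
  refine HE_sum_right s _ _ _ ?_ ?_
  · rintro ⟨k, l⟩ _
    simp [sub_dotProduct]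
    ring
  · rintro ⟨k, l⟩ _
    by_cases hkl : k = l
    · subst hkl
      simpa [tv_zero_right] using Submonoid.one_mem _
    · exact HE_V1 h3 s _ u k l hkl

end Exc

end PDsec

section PD2sec
open Polynomial Matrix

lemma tv_conj {ι B : Type*} [DecidableEq ι] [Fintype ι] [CommRing B] (σ τ : Matrix ι ι B)
    (h : τ * σ = 1) (x ω : ι → B) : τ * tv x ω * σ = tv (τ *ᵥ x) (ω ᵥ* σ) := by
  unfold tv
  rw [mul_add, add_mul, mul_one, h, mul_vecMulVec, vecMulVec_mul]

lemma tv_mulVec {ι B : Type*} [DecidableEq ι] [Fintype ι] [CommRing B] (i j : ι) (c : B)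
    (w : ι → B) : tv (Pi.single i c) (Pi.single j 1) *ᵥ w = Function.update w i (w i + c * w j) := by
  unfold tv
  rw [add_mulVec, one_mulVec, vecMulVec_mulVec]
  funext k
  by_cases hk : k = i
  · subst hk; simp [mul_comm]
  · simp [hk]

lemma path_exc {ι R : Type*} [DecidableEq ι] [Fintype ι] [CommRing R]
    (h3 : ∀ k l : ι, ∃ j, j ≠ k ∧ j ≠ l) (s : R) (v w : ι → (Rp (s ^ 2))[X]) (h : El v w) :
    ∃ σ τ : Matrix ι ι R[X], σ * τ = 1 ∧ τ * σ = 1 ∧ ∃ η ∈ HE ι (C s : R[X]),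
      (σ * η) *ᵥ (fun i => (v i).map (rp1 _)) = (fun i => (w i).map (rp1 _)) ∧
      σ *ᵥ (fun i => (v i).map (rp2 _)) = (fun i => (w i).map (rp2 _)) := by
  induction h with
  | refl => exact ⟨1, 1, by simp, by simp, 1, Submonoid.one_mem _, by simp, by simp⟩
  | tail _ h2 ih =>
    rename_i w _ _
    obtain ⟨σ, τ, hst, hts, η, hη, e1, e2⟩ := ih
    obtain ⟨i, j, c, hij, rfl⟩ := h2
    obtain ⟨g, hg⟩ : ∃ g, c.map (rp1 (s ^ 2)) = c.map (rp2 _) + (C s) ^ 2 * g := by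
      have : C (s ^ 2) ∣ c.map (rp1 (s ^ 2)) - c.map (rp2 _) := by
        rw [C_dvd_iff_dvd_coeff]
        intro n
        rw [coeff_sub, coeff_map, coeff_map]
        exact (c.coeff n).2
      obtain ⟨g, hg⟩ := this
      exact ⟨g, by rw [← C_pow, ← hg]; ring⟩
    set c1 := c.map (rp1 (s ^ 2))
    set c2 := c.map (rp2 (s ^ 2))
    have hsum : ∀ x y : R[X], tv (Pi.single i x) (Pi.single j 1) * tv (Pi.single i y) (Pi.single j 1)
        = tv (Pi.single i (x + y)) (Pi.single j 1) := by
      intro x y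
      rw [tv_mul_left _ _ _ (by simp [hij.symm]), Pi.single_add]
    have hz : tv (Pi.single i (0 : R[X])) (Pi.single j 1) = 1 := by
      rw [Pi.single_zero, tv_zero_left]
    have hmap : ∀ f : Rp (s ^ 2) →+* R, (fun k => (Function.update w i (w i + c * w j) k).map f) =
        tv (Pi.single i (c.map f)) (Pi.single j 1) *ᵥ (fun k => (w k).map f) := by
      intro f
      rw [tv_mulVec]
      funext k
      by_cases hk : k = i
      · subst hk; simp
      · simp [hk]
    have hH : τ * tv (Pi.single i (C s ^ 2 * g)) (Pi.single j 1) * σ ∈ HE ι (C s : R[X]) := by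
      rw [tv_conj σ τ hts]
      have e : (Pi.single i (C s ^ 2 * g) : ι → R[X]) = (C s ^ 2 * g) • Pi.single i 1 := by
        rw [← Pi.single_smul]; simp
      rw [e, mulVec_smul]
      refine HE_V h3 (C s) g (τ *ᵥ Pi.single i 1) (Pi.single i 1 ᵥ* σ) _ ?_ ?_
      · rw [← dotProduct_mulVec, mulVec_mulVec, hst]; simp [hij.symm]
      · rw [← dotProduct_mulVec, mulVec_mulVec, hst]; simp
    refine ⟨tv (Pi.single i c2) (Pi.single j 1) * σ, τ * tv (Pi.single i (-c2)) (Pi.single j 1),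
      ?_, ?_, τ * tv (Pi.single i (C s ^ 2 * g)) (Pi.single j 1) * σ * η,
      Submonoid.mul_mem _ hH hη, ?_, ?_⟩
    · rw [mul_assoc, ← mul_assoc σ, hst, one_mul, hsum, add_neg_cancel, hz]
    · rw [mul_assoc, ← mul_assoc _ _ σ, hsum, neg_add_cancel, hz, one_mul, hts]
    · have e : tv (Pi.single i c2) (Pi.single j 1) * σ *
          (τ * tv (Pi.single i (C s ^ 2 * g)) (Pi.single j 1) * σ * η) =
          tv (Pi.single i c1) (Pi.single j 1) * (σ * η) := by
        rw [hg, ← hsum]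
        calc _ = tv (Pi.single i c2) (Pi.single j 1) * (σ * τ) *
            tv (Pi.single i (C s ^ 2 * g)) (Pi.single j 1) * (σ * η) := by
              simp only [mul_assoc]
          _ = _ := by rw [hst, mul_one]
      rw [e, ← mulVec_mulVec, e1, hmap]
    · rw [← mulVec_mulVec, e2, hmap]

theorem excision {R : Type*} [CommRing R] (n : ℕ) (s : R) (h1 : KD (⊥ : Submonoid R) ⊥ (n + 2))
    (h2 : KD (monics R) ⊥ (n + 2)) (v b : Fin (n + 3) → R[X])
    (hv : Ideal.span (Set.range v) = ⊤)
    (hb : ∀ i, v i = (Pi.single 0 1 : Fin (n + 3) → R[X]) i + (C s) ^ 2 * b i) :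
    ∃ η ∈ HE (Fin (n + 3)) (C s : R[X]), η *ᵥ v = Pi.single 0 1 := by
  let R' := Rp (s ^ 2)
  let D : R[X] →+* R'[X] := mapRingHom (rpDiag (s ^ 2))
  let p1 : R'[X] →+* R[X] := mapRingHom (rp1 (s ^ 2))
  let p2 : R'[X] →+* R[X] := mapRingHom (rp2 (s ^ 2))
  have hp1 : ∀ x, p1 (D x) = x := by
    intro x
    change (x.map _).map _ = x
    rw [Polynomial.map_map]; exact Polynomial.map_id
  have hp2 : ∀ x, p2 (D x) = x := by
    intro x
    change (x.map _).map _ = x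
    rw [Polynomial.map_map]; exact Polynomial.map_id
  let v' : Fin (n + 3) → R'[X] := fun i =>
    D ((Pi.single 0 1 : Fin (n + 3) → R[X]) i) + C (rpB (s ^ 2)) * D (b i)
  have hv1 : ∀ i, p1 (v' i) = v i := by
    intro i
    rw [map_add, map_mul, hp1, hp1, hb]
    have : p1 (C (rpB (s ^ 2))) = C s ^ 2 := by
      change (C (rpB (s ^ 2))).map _ = _
      rw [map_C, ← C_pow]; rfl
    rw [this]
  have hv2 : ∀ i, p2 (v' i) = (Pi.single 0 1 : Fin (n + 3) → R[X]) i := by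
    intro i
    rw [map_add, map_mul, hp2, hp2]
    have : p2 (C (rpB (s ^ 2))) = 0 := by
      change (C (rpB (s ^ 2))).map _ = _
      rw [map_C]; exact C_0
    rw [this]; ring
  have hker : RingHom.ker p1 ≤ Ideal.span {C (rpA (s ^ 2))} := by
    rw [Polynomial.ker_mapRingHom]
    refine (Ideal.map_mono (rp1_ker _)).trans ?_
    rw [Ideal.map_span, Set.image_singleton]
  have htop : Ideal.span (Set.range v') = ⊤ := by
    have : (1 : R[X]) ∈ Ideal.span (Set.range v) := by rw [hv]; trivial
    obtain ⟨c, hc⟩ := Ideal.mem_span_range_iff_exists_fun.1 this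
    have hx : ∑ i, D (c i) * v' i ∈ Ideal.span (Set.range v') :=
      Ideal.sum_mem _ fun i _ => Ideal.mul_mem_left _ _ (Ideal.subset_span ⟨i, rfl⟩)
    have hx1 : ∑ i, D (c i) * v' i - 1 ∈ RingHom.ker p1 := by
      rw [RingHom.mem_ker, map_sub, map_sum, map_one]
      simp only [map_mul, hp1, hv1]
      rw [hc, sub_self]
    obtain ⟨z, hz⟩ := Ideal.mem_span_singleton'.1 (hker hx1)
    have hA : C (rpA (s ^ 2)) ∈ Ideal.span (Set.range v') := by
      have : C (rpA (s ^ 2)) = C (rpA (s ^ 2)) * v' 0 := by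
        have hAB : (C (rpA (s ^ 2)) : R'[X]) * C (rpB (s ^ 2)) = 0 := by
          rw [← C_mul, rpAB, C_0]
        simp only [v', Pi.single_eq_same, map_one]
        linear_combination (- D (b 0)) * hAB
      rw [this]
      exact Ideal.mul_mem_left _ _ (Ideal.subset_span ⟨0, rfl⟩)
    rw [Ideal.eq_top_iff_one]
    have e : (1 : R'[X]) = ∑ i, D (c i) * v' i - z * C (rpA (s ^ 2)) := by rw [hz]; ring
    rw [e]
    exact Ideal.sub_mem _ hx (Ideal.mul_mem_left _ _ hA)
  have hE := free_thm n (KD_Rp (s ^ 2) _ h1) (KD_Rp_monics (s ^ 2) _ h2) v' htop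
  have h3 : ∀ k l : Fin (n + 3), ∃ j, j ≠ k ∧ j ≠ l := by
    intro k l
    have : (({k, l} : Finset (Fin (n + 3)))ᶜ).Nonempty := by
      rw [← Finset.card_pos, Finset.card_compl, Fintype.card_fin]
      have := Finset.card_le_two (a := k) (b := l)
      omega
    obtain ⟨j, hj⟩ := this
    simp at hj
    exact ⟨j, hj.1, hj.2⟩
  obtain ⟨σ, τ, hst, hts, η, hη, e1, e2⟩ := path_exc h3 s v' _ hE
  have q1 : (fun i => (v' i).map (rp1 (s ^ 2))) = v := funext hv1
  have q2 : (fun i => (v' i).map (rp2 (s ^ 2))) = Pi.single 0 1 := funext hv2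
  have q3 : ∀ f : R' →+* R, (fun i => ((Pi.single 0 1 : Fin (n + 3) → R'[X]) i).map f) =
      Pi.single 0 1 := by
    intro f
    funext i
    by_cases hi : i = 0
    · subst hi; simp
    · simp [hi]
  rw [q1, q3] at e1
  rw [q2, q3] at e2
  refine ⟨η, hη, ?_⟩
  calc η *ᵥ v = τ *ᵥ ((σ * η) *ᵥ v) := by
        rw [mulVec_mulVec, ← mul_assoc, hts, one_mul]
    _ = τ *ᵥ (σ *ᵥ Pi.single 0 1) := by rw [e1, e2]
    _ = Pi.single 0 1 := by rw [mulVec_mulVec, hts, one_mulVec]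

end PD2sec


lemma two_lift {A : Type*} [CommRing A] (S : Submonoid A) {M N M' N' : Type*} [AddCommGroup M]
    [Module A M] [AddCommGroup N] [Module A N] [AddCommGroup M'] [Module A M']
    [AddCommGroup N'] [Module A N'] [Module.FinitePresentation A M] [Module.FinitePresentation A N]
    (f : M →ₗ[A] M') [IsLocalizedModule S f] (g : N →ₗ[A] N') [IsLocalizedModule S g]
    (e : M' ≃ₗ[A] N') : ∃ s ∈ S, ∃ (l : M →ₗ[A] N) (k : N →ₗ[A] M),
      (∀ x, k (l x) = s • x) ∧ ∀ x, l (k x) = s • x := by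
  obtain ⟨l, s0, H0⟩ := Module.FinitePresentation.exists_lift_of_isLocalizedModule S g
    (e.toLinearMap.comp f)
  obtain ⟨k, s1, H1⟩ := Module.FinitePresentation.exists_lift_of_isLocalizedModule S f
    (e.symm.toLinearMap.comp g)
  have h0 : ∀ x, g (l x) = (s0 : A) • e (f x) := fun x => LinearMap.congr_fun H0 x
  have h1 : ∀ x, f (k x) = (s1 : A) • e.symm (g x) := fun x => LinearMap.congr_fun H1 x
  obtain ⟨s2, h2⟩ := Module.Finite.exists_smul_of_comp_eq_of_isLocalizedModule S f
    (k ∘ₗ l) (((s0 : A) * s1) • LinearMap.id) (by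
      ext x
      simp [h0, h1, smul_smul, mul_comm])
  obtain ⟨s3, h3⟩ := Module.Finite.exists_smul_of_comp_eq_of_isLocalizedModule S g
    (l ∘ₗ k) (((s0 : A) * s1) • LinearMap.id) (by
      ext x
      simp [h0, h1, smul_smul, mul_comm])
  have h2' : ∀ x, (s2 : A) • k (l x) = (s2 : A) • ((s0 : A) * s1) • x := fun x => LinearMap.congr_fun h2 x
  have h3' : ∀ x, (s3 : A) • l (k x) = (s3 : A) • ((s0 : A) * s1) • x := fun x => LinearMap.congr_fun h3 x
  refine ⟨s2 * s3 * (s0 * s1), S.mul_mem (S.mul_mem s2.2 s3.2) (S.mul_mem s0.2 s1.2), l,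
    ((s2 : A) * s3) • k, ?_, ?_⟩
  · intro x
    rw [LinearMap.smul_apply, mul_comm (s2 : A), mul_smul, h2', smul_smul, smul_smul]
  · intro x
    rw [LinearMap.smul_apply, map_smul, mul_smul, h3', smul_smul, smul_smul]

lemma loc_basis {A : Type*} [CommRing A] (S : Submonoid A) {P : Type*} [AddCommGroup P] [Module A P]
    [Module.FinitePresentation A P] (r : ℕ)
    [Module.Free (Localization S) (LocalizedModule S P)] [Nontrivial (Localization S)]
    (hr : Module.finrank (Localization S) (LocalizedModule S P) = r) :
    ∃ s ∈ S, ∃ (e : Fin r → P) (φ : Fin r → P →ₗ[A] A),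
      (∀ i j, φ i (e j) = if i = j then s else 0) ∧ ∀ p, s • p = ∑ i, φ i p • e i := by
  have : Module.Finite (Localization S) (LocalizedModule S P) := inferInstance
  let b := Module.finBasisOfFinrankEq (Localization S) (LocalizedModule S P) hr
  let e : LocalizedModule S P ≃ₗ[A] (Fin r → Localization S) := b.equivFun.restrictScalars A
  obtain ⟨s, hs, l, k, h1, h2⟩ := two_lift S (LocalizedModule.mkLinearMap S P)
    (LinearMap.pi fun i : Fin r => Algebra.linearMap A (Localization S) ∘ₗ LinearMap.proj i) e
  refine ⟨s, hs, fun j => k (Pi.single j 1), fun i => LinearMap.proj i ∘ₗ l, ?_, ?_⟩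
  · intro i j
    simp [h2, Pi.single_apply]
  · intro p
    rw [← h1]
    conv_lhs => rw [pi_eq_sum_univ' (l p)]
    rw [map_sum]
    refine Finset.sum_congr rfl fun i _ => ?_
    rw [map_smul]
    congr 2

lemma prime_list {A : Type*} [CommRing A] {P : Type*} [AddCommGroup P] [Module A P]
    [Module.FinitePresentation A P] (r : ℕ)
    (h : ∀ (𝔭 : Ideal A) (h𝔭 : 𝔭.IsPrime),
    haveI := h𝔭
    Module.Free (Localization.AtPrime 𝔭) (LocalizedModule 𝔭.primeCompl P) ∧
    Module.finrank (Localization.AtPrime 𝔭) (LocalizedModule 𝔭.primeCompl P) = r) :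
    ∃ L : List ((Fin r → P) × (Fin r → P →ₗ[A] A)),
    ∀ Q : Ideal A, Q.IsPrime → ∃ l ∈ L, (Matrix.of fun i j => l.2 i (l.1 j)).det ∉ Q := by
  let D : ((Fin r → P) × (Fin r → P →ₗ[A] A)) → A :=
    fun l => (Matrix.of fun i j => l.2 i (l.1 j)).det
  have htop : Ideal.span (Set.range D) = ⊤ := by
    by_contra hne
    obtain ⟨Q, hQ, hle⟩ := Ideal.exists_le_maximal _ hne
    have hp := hQ.isPrime
    obtain ⟨hf, hr⟩ := h Q hp
    obtain ⟨s, hs, e, φ, h1, -⟩ := loc_basis Q.primeCompl r hr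
    have hd : D (e, φ) = s ^ r := by
      have : (Matrix.of fun i j => φ i (e j)) = Matrix.diagonal fun _ => s := by
        ext i j
        simp [h1, Matrix.diagonal_apply]
      change Matrix.det _ = _
      rw [this]; simp
    apply hs
    refine hp.mem_of_pow_mem r ?_
    rw [← hd]
    exact hle (Ideal.subset_span ⟨_, rfl⟩)
  have h1 : (1 : A) ∈ Ideal.span (Set.range D) := by rw [htop]; trivial
  obtain ⟨c, hc⟩ := Finsupp.mem_ideal_span_range_iff_exists_finsupp.1 h1
  refine ⟨c.support.toList, fun Q hQ => ?_⟩
  by_contra! hcon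
  apply hQ.ne_top
  rw [Ideal.eq_top_iff_one, ← hc]
  exact Ideal.sum_mem _ fun l hl => Ideal.mul_mem_left _ _ (hcon l (Finset.mem_toList.2 hl))

lemma pir_loc {B T : Type*} [CommRing B] [CommRing T] [Algebra B T] (M : Submonoid B)
    [IsLocalization M T] [IsPrincipalIdealRing B] : IsPrincipalIdealRing T where
  principal J := by
    obtain ⟨x, hx⟩ := IsPrincipalIdealRing.principal (J.under B)
    refine ⟨algebraMap B T x, ?_⟩
    rw [← IsLocalization.map_under M T J, hx]
    rw [Ideal.submodule_span_eq, Ideal.map_span, Set.image_singleton]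

attribute [local instance] Polynomial.algebra in
lemma generic_basis {R : Type*} [CommRing R] [IsDomain R] (f : R[X]) (hf : f ≠ 0)
    (A : Type*) [CommRing A] [Algebra R[X] A] [IsLocalization.Away f A]
    (P : Type*) [AddCommGroup P] [Module A P] [Module.Finite A P] [Module.Projective A P]
    (r : ℕ)
    (h : ∀ (𝔭 : Ideal A) (h𝔭 : 𝔭.IsPrime),
    haveI := h𝔭
    Module.Free (Localization.AtPrime 𝔭) (LocalizedModule 𝔭.primeCompl P) ∧
    Module.finrank (Localization.AtPrime 𝔭) (LocalizedModule 𝔭.primeCompl P) = r) :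
    ∃ s : R, s ≠ 0 ∧ ∃ (e : Fin r → P) (φ : Fin r → P →ₗ[A] A),
      (∀ i j, φ i (e j) = if i = j then algebraMap R[X] A (C s) else 0) ∧
      ∀ p, algebraMap R[X] A (C s) • p = ∑ i, φ i p • e i := by
  let M := (nonZeroDivisors R).map (C : R →+* R[X])
  let S := Algebra.algebraMapSubmonoid A M
  let T := Localization S
  let K := FractionRing R
  have hM : M ≤ nonZeroDivisors R[X] := by
    rintro _ ⟨x, hx, rfl⟩
    exact mem_nonZeroDivisors_of_ne_zero (C_ne_zero.2 (nonZeroDivisors.ne_zero hx))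
  haveI : IsDomain A := IsLocalization.isDomain_of_le_nonZeroDivisors A
    (M := Submonoid.powers f) (powers_le_nonZeroDivisors_of_noZeroDivisors hf)
  have hS : S ≤ nonZeroDivisors A := by
    rintro _ ⟨x, hx, rfl⟩
    refine mem_nonZeroDivisors_of_ne_zero fun h0 => nonZeroDivisors.ne_zero (hM hx) ?_
    apply (IsLocalization.injective A (M := Submonoid.powers f)
      (powers_le_nonZeroDivisors_of_noZeroDivisors hf))
    rw [h0, map_zero]
  haveI : IsDomain T := IsLocalization.isDomain_localization hS
  haveI : IsLocalization M K[X] := Polynomial.isLocalization _ _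
  letI : Algebra K[X] T := (IsLocalization.lift (M := M) (g := algebraMap R[X] T) (by
    rintro ⟨x, hx⟩
    rw [IsScalarTower.algebraMap_apply R[X] A T]
    exact IsLocalization.map_units T (⟨_, x, hx, rfl⟩ : S))).toAlgebra
  haveI : IsScalarTower R[X] K[X] T := IsScalarTower.of_algebraMap_eq fun x => by
    symm
    exact IsLocalization.lift_eq _ x
  haveI := IsLocalization.commutes K[X] A T M (Submonoid.powers f)
  haveI : IsPrincipalIdealRing T := pir_loc (Algebra.algebraMapSubmonoid K[X] (Submonoid.powers f))
  haveI : Module.FinitePresentation A P := Module.finitePresentation_of_projective A P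
  haveI : Module.Projective T (LocalizedModule S P) := inferInstance
  haveI : Module.Free T (LocalizedModule S P) := inferInstance
  have hrk : Module.finrank T (LocalizedModule S P) = r := by
    let p : PrimeSpectrum T := ⟨⊥, Ideal.isPrime_bot⟩
    have h1 := Module.rankAtStalk_isBaseChange (M := P) (IsLocalizedModule.isBaseChange S T
      (LocalizedModule.mkLinearMap S P)) p
    rw [Module.rankAtStalk_eq_finrank_of_free] at h1
    exact h1.trans (h _ _).2
  obtain ⟨_, ⟨_, ⟨s, hs, rfl⟩, rfl⟩, e, φ, h1, h2⟩ := loc_basis S r hrk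
  exact ⟨s, nonZeroDivisors.ne_zero hs, e, φ, h1, h2⟩


section ETsec
variable {A : Type*} [CommRing A] {P : Type*} [AddCommGroup P] [Module A P]

/-- Equivalence under the transvection group. -/
def ET (v w : A × P) : Prop := ∃ σ ∈ TransvectionGroup A (A × P), σ v = w

lemma ET.symm {v w : A × P} (h : ET v w) : ET w v := by
  obtain ⟨σ, hσ, rfl⟩ := h
  exact ⟨σ⁻¹, Subgroup.inv_mem _ hσ, σ.symm_apply_apply v⟩

lemma ET.trans {u v w : A × P} (h : ET u v) (h' : ET v w) : ET u w := by
  obtain ⟨σ, hσ, rfl⟩ := h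
  obtain ⟨τ, hτ, rfl⟩ := h'
  exact ⟨τ * σ, Subgroup.mul_mem _ hτ hσ, rfl⟩

lemma ET.refl (v : A × P) : ET v v := ⟨1, Subgroup.one_mem _, rfl⟩

lemma ET.uni {v w : A × P} (h : ET v w) (hv : IsUnimodular A (A × P) v) :
    IsUnimodular A (A × P) w := by
  obtain ⟨σ, hσ, rfl⟩ := h
  obtain ⟨φ, hφ⟩ := hv
  exact ⟨φ ∘ₗ σ.symm.toLinearMap, by simp [hφ]⟩

lemma ET.of_transv (p : A × P) (φ : (A × P) →ₗ[A] A) (h : φ p = 0)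
    (hu : IsUnimodular A (A × P) p ∨ IsUnimodular A ((A × P) →ₗ[A] A) φ) (v : A × P) :
    ET v (v + φ v • p) := by
  let σ : (A × P) ≃ₗ[A] (A × P) := LinearEquiv.ofLinear
    (LinearMap.id + φ.smulRight p) (LinearMap.id - φ.smulRight p)
    (LinearMap.ext fun x => by simp [h]) (LinearMap.ext fun x => by simp [h])
  exact ⟨σ, Subgroup.subset_closure ⟨p, φ, h, hu, fun q => rfl⟩, rfl⟩

lemma ET.T1 (a : A) (p q : P) : ET (a, p) (a, p + a • q) := by
  have := ET.of_transv (0, q) (LinearMap.fst A A P) rfl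
    (Or.inr ⟨LinearMap.applyₗ ((1, 0) : A × P), by simp⟩) (a, p)
  simpa using this

lemma ET.T2 (a : A) (p : P) (ψ : P →ₗ[A] A) : ET (a, p) (a + ψ p, p) := by
  have := ET.of_transv ((1, 0) : A × P) (ψ ∘ₗ LinearMap.snd A A P) (by simp)
    (Or.inl ⟨LinearMap.fst A A P, by simp⟩) (a, p)
  simpa using this

lemma ET.T3 (a : A) (p q : P) (ψ : P →ₗ[A] A) (h : ψ q = 0) :
    ET (a, p) (a, p + ψ p • q) := by
  have h1 := ET.T2 a p ψ
  have h2 := ET.T1 (a + ψ p) p q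
  have h3 := ET.T2 (a + ψ p) (p + (a + ψ p) • q) (-ψ)
  have h4 := ET.T1 a (p + (a + ψ p) • q) (-q)
  have e3 : a + ψ p + (-ψ) (p + (a + ψ p) • q) = a := by simp [h]
  have e4 : p + (a + ψ p) • q + a • -q = p + ψ p • q := by
    rw [add_smul, smul_neg]; abel
  rw [e3] at h3
  rw [e4] at h4
  exact ((h1.trans h2).trans h3).trans h4

/-- The map from rows over `B` to `A × P` given by `e`. -/
def Tht {B : Type*} [CommRing B] [Algebra B A] {r : ℕ} (e : Fin r → P) (z : Fin (r + 1) → B) :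
    A × P := (algebraMap B A (z 0), ∑ i, algebraMap B A (z i.succ) • e i)

lemma Tht_zero {B : Type*} [CommRing B] [Algebra B A] {r : ℕ} (e : Fin r → P)
    (z : Fin (r + 1) → B) (y : B) : Tht (A := A) e (Function.update z 0 (z 0 + y)) =
      (algebraMap B A (z 0) + algebraMap B A y, ∑ i, algebraMap B A (z i.succ) • e i) := by
  simp [Tht]

lemma Tht_succ {B : Type*} [CommRing B] [Algebra B A] {r : ℕ} (e : Fin r → P)
    (z : Fin (r + 1) → B) (y : B) (i : Fin r) :
    Tht (A := A) e (Function.update z i.succ (z i.succ + y)) =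
      (algebraMap B A (z 0), (∑ i, algebraMap B A (z i.succ) • e i) + algebraMap B A y • e i) := by
  unfold Tht
  refine Prod.ext ?_ ?_
  · simp [Function.update_of_ne (Fin.succ_ne_zero i).symm]
  · change ∑ k, algebraMap B A (Function.update z i.succ (z i.succ + y) k.succ) • e k = _
    rw [← Finset.add_sum_erase _ _ (Finset.mem_univ i)]
    conv_rhs => rw [← Finset.add_sum_erase _ _ (Finset.mem_univ i)]
    rw [Function.update_self, map_add, add_smul, add_right_comm]
    congr 2
    refine Finset.sum_congr rfl fun k hk => ?_
    rw [Function.update_of_ne]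
    intro h
    exact (Finset.ne_of_mem_erase hk) (Fin.succ_injective _ h)

lemma HE_act {B : Type*} [CommRing B] [Algebra B A] {r : ℕ} (s : B) (e : Fin r → P)
    (φ : Fin r → P →ₗ[A] A) (h : ∀ i j, φ i (e j) = if i = j then algebraMap B A s else 0)
    (η : Matrix (Fin (r + 1)) (Fin (r + 1)) B) (hη : η ∈ HE (Fin (r + 1)) s) :
    ∀ z, ET (Tht (A := A) e z) (Tht e (η.mulVec z)) := by
  have hφ : ∀ (j : Fin r) (w : Fin r → A), φ j (∑ i, w i • e i) = algebraMap B A s * w j := by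
    intro j w
    rw [map_sum]
    simp [h, mul_comm]
  unfold HE at hη
  induction hη using Submonoid.closure_induction with
  | one => intro z; rw [Matrix.one_mulVec]; exact ET.refl _
  | mul x y _ _ hx hy =>
    intro z
    rw [← Matrix.mulVec_mulVec]
    exact (hy z).trans (hx _)
  | mem x hx =>
    obtain ⟨i, j, c, hij, rfl⟩ := hx
    intro z
    rw [tv_mulVec]
    refine Fin.cases (motive := fun i => i ≠ j → ET (Tht (A := A) e z)
      (Tht e (Function.update z i (z i + s * c * z j)))) ?_ ?_ i hij
    · intro hj
      obtain ⟨j, rfl⟩ := Fin.exists_succ_eq.2 hj.symm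
      rw [Tht_zero]
      have := ET.T2 (algebraMap B A (z 0)) (∑ i, algebraMap B A (z i.succ) • e i)
        (algebraMap B A c • φ j)
      rw [LinearMap.smul_apply, hφ j (fun i => algebraMap B A (z i.succ))] at this
      have e1 : algebraMap B A (s * c * z j.succ) =
          algebraMap B A c • (algebraMap B A s * algebraMap B A (z j.succ)) := by
        simp only [map_mul, smul_eq_mul]
        ring
      rw [e1]
      exact this
    · intro i
      rw [Tht_succ]
      refine Fin.cases (motive := fun j => i.succ ≠ j → ET (Tht (A := A) e z) (_, _ + algebraMap B A (s * c * z j) • e i)) ?_ ?_ j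
      · intro _
        have := ET.T1 (algebraMap B A (z 0)) (∑ i, algebraMap B A (z i.succ) • e i)
          (algebraMap B A (s * c) • e i)
        have e1 : algebraMap B A (s * c * z 0) • e i =
            algebraMap B A (z 0) • algebraMap B A (s * c) • e i := by
          rw [smul_smul, ← map_mul, mul_comm]
        rw [e1]
        exact this
      · intro j hj
        have hj' : j ≠ i := fun h => hj (by rw [h])
        have := ET.T3 (algebraMap B A (z 0)) (∑ i, algebraMap B A (z i.succ) • e i)
          (e i) (algebraMap B A c • φ j) (by simp [h, hj'])
        rw [LinearMap.smul_apply, hφ j (fun i => algebraMap B A (z i.succ))] at this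
        have e1 : algebraMap B A (s * c * z j.succ) =
            algebraMap B A c • (algebraMap B A s * algebraMap B A (z j.succ)) := by
          simp only [map_mul, smul_eq_mul]
          ring
        rw [e1]
        exact this

end ETsec


lemma to_one {R : Type*} [CommRing R] [IsDomain R] (n : ℕ)
    (hR : KD (⊥ : Submonoid R) ⊥ (n + 2))
    (hX : ∀ c : LTSeries (PrimeSpectrum R[X]), c.length ≤ n + 2)
    (f : R[X]) (hf : f ≠ 0) (A : Type*) [CommRing A] [Algebra R[X] A] [IsLocalization.Away f A]
    (P : Type*) [AddCommGroup P] [Module A P] [Module.Finite A P] [Module.Projective A P]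
    (h : HasConstantRank A P (n + 2)) (v : A × P) (hv : IsUnimodular A (A × P) v) :
    ET v (1, 0) := by
  haveI : Module.FinitePresentation A P := Module.finitePresentation_of_projective A P
  obtain ⟨L, hL⟩ := prime_list (n + 2) h
  obtain ⟨s, hs, e, φ, he, hsp⟩ := generic_basis f hf A P (n + 2) h
  have cs : ∀ w : A × P, IsUnimodular A (A × P) w → ∃ (c : A) (χ : P →ₗ[A] A),
      c * w.1 + χ w.2 = 1 := by
    rintro ⟨a, p⟩ ⟨Φ, hΦ⟩
    refine ⟨Φ (1, 0), Φ ∘ₗ LinearMap.inr A A P, ?_⟩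
    refine Eq.trans ?_ hΦ
    have : ((a, p) : A × P) = a • (1, 0) + (0, p) := by simp
    rw [this, map_add, map_smul]
    simp [mul_comm]
  let al := algebraMap R[X] A
  -- first step
  obtain ⟨a1, b, p1, ha1, h1⟩ : ∃ (a1 b : A) (p1 : P), a1 = 1 + al (C s) ^ 3 * b ∧
      ET v (a1, p1) := by
    obtain ⟨a, p⟩ := v
    obtain ⟨c, χ, hc⟩ := cs _ hv
    obtain ⟨q, ψ, σ, hσ, hq⟩ := bass (⊥ : Submonoid A) (Ideal.span {al (C s) ^ 3}) (n + 2)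
      (KD_loc_s (Submonoid.powers f) (n + 2) hX (C s) (C_ne_zero.2 hs) 3) L hL a p c χ hc
    rw [Submonoid.mem_bot] at hσ
    subst hσ
    obtain ⟨t, ht⟩ := Ideal.mem_span_singleton'.1 hq
    refine ⟨_, (1 - a) * t, p + a • q, ?_, (ET.T1 a p q).trans (ET.T2 a (p + a • q) ((1 - a) • ψ))⟩
    rw [LinearMap.smul_apply, smul_eq_mul]
    linear_combination (a - 1) * ht
  have hu1 := h1.uni hv
  -- second step
  obtain ⟨c1, χ1, hc1⟩ := cs _ hu1
  obtain ⟨q, ψ, σ, hσ, hq⟩ := bass ((onePlus f).map al) ⊥ (n + 2)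
      (KD_loc_f f (n + 2) hX) L hL a1 p1 c1 χ1 hc1
  obtain ⟨_, ⟨g, rfl⟩, rfl⟩ := hσ
  rw [Ideal.mem_bot, sub_eq_zero] at hq
  set p2 := p1 + a1 • q with hp2
  have h2 : ET v (a1, p2) := h1.trans (ET.T1 a1 p1 q)
  obtain ⟨⟨_, m, rfl⟩, hm⟩ := IsLocalization.exist_integer_multiples_of_finite
    (Submonoid.powers f) (fun i : Option (Fin (n + 2)) => i.elim b (fun i => φ i p2))
  obtain ⟨b', hb'⟩ := hm none
  have hy : ∀ i : Fin (n + 2), ∃ y, al y = al f ^ m * φ i p2 := by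
    intro i
    obtain ⟨y, hy⟩ := hm (some i)
    refine ⟨y, ?_⟩
    rw [Algebra.smul_def] at hy
    simpa [al] using hy
  choose y hy using hy
  rw [Algebra.smul_def] at hb'
  replace hb' : al b' = al f ^ m * b := by simpa [al] using hb'
  set u : R[X] := b' * (-g) ^ (2 * m + 1) with hu
  obtain ⟨t, ht⟩ : al (1 + f * g) ∣ 1 - (- (al f * al g)) ^ (2 * m + 1) := by
    have := sub_dvd_pow_sub_pow (1 : A) (- (al f * al g)) (2 * m + 1)
    rw [one_pow] at this
    convert this using 1
    simp [al]
  have h3 := ET.T2 a1 p2 ((-(al (C s) ^ 3 * b * t)) • ψ)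
  have ea : a1 + ((-(al (C s) ^ 3 * b * t)) • ψ) p2 = al (1 + C s ^ 3 * f ^ (m + 1) * u) := by
    rw [LinearMap.smul_apply, hq, ha1, smul_eq_mul, hu]
    simp only [map_add, map_mul, map_pow, map_neg, map_one, hb'] at ht ⊢
    have e1 : (-(al f * al g)) ^ (2 * m + 1) = al f ^ (m + 1) * al f ^ m * (- al g) ^ (2 * m + 1) := by
      rw [← pow_add, ← mul_neg, mul_pow]; congr 2; ring
    rw [e1] at ht
    linear_combination al (C s) ^ 3 * b * ht
  rw [ea] at h3
  have h4 := ET.T1 (al (1 + C s ^ 3 * f ^ (m + 1) * u)) p2 (-p2)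
  let bb : Fin (n + 3) → R[X] := Fin.cons (C s * f ^ (m + 1) * u) (fun i => - (f * u * y i))
  let z : Fin (n + 3) → R[X] := fun i =>
    (Pi.single 0 1 : Fin (n + 3) → R[X]) i + (C s) ^ 2 * bb i
  have hz0 : z 0 = 1 + C s ^ 3 * f ^ (m + 1) * u := by
    simp only [z, bb, Pi.single_eq_same, Fin.cons_zero]; ring
  have hzs : ∀ i : Fin (n + 2), z i.succ = C s ^ 2 * - (f * u * y i) := by
    intro i
    simp only [z, bb, Fin.cons_succ]
    simp
  have ep : p2 + al (1 + C s ^ 3 * f ^ (m + 1) * u) • -p2 = ∑ i, al (z i.succ) • e i := by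
    have e1 : p2 + al (1 + C s ^ 3 * f ^ (m + 1) * u) • -p2 =
        (-(al (C s) ^ 2 * al f ^ (m + 1) * al u)) • al (C s) • p2 := by
      rw [smul_smul, smul_neg, map_add, map_one, add_smul, one_smul, neg_add, add_neg_cancel_left,
        ← neg_smul]
      congr 1
      simp only [map_mul, map_pow]
      ring
    rw [e1]
    change _ • algebraMap R[X] A (C s) • p2 = _
    rw [hsp, Finset.smul_sum]
    refine Finset.sum_congr rfl fun i _ => ?_
    rw [smul_smul, hzs]
    congr 1
    simp only [map_mul, map_pow, map_neg, hy]
    ring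
  have h5 : ET v (Tht e z) := by
    rw [ep, ← hz0] at h4
    rw [← hz0] at h3
    exact (h2.trans h3).trans h4
  have htop : Ideal.span (Set.range z) = ⊤ := by
    by_contra hne
    obtain ⟨Q, hQ, hle⟩ := Ideal.exists_le_maximal _ hne
    have hzQ : ∀ i, z i ∈ Q := fun i => hle (Ideal.subset_span ⟨i, rfl⟩)
    have hfQ : f ∉ Q := by
      intro hfQ
      apply hQ.ne_top
      rw [Ideal.eq_top_iff_one]
      have e1 : (1 : R[X]) = z 0 - (C s ^ 3 * f ^ m * u) * f := by rw [hz0]; ring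
      rw [e1]
      exact Ideal.sub_mem _ (hzQ 0) (Ideal.mul_mem_left _ _ hfQ)
    have hmap : Q.map (algebraMap R[X] A) ≠ ⊤ := by
      rw [IsLocalization.map_algebraMap_ne_top_iff_disjoint (Submonoid.powers f)]
      rw [Set.disjoint_left]
      rintro _ ⟨k, rfl⟩ hk
      exact hfQ (hQ.isPrime.mem_of_pow_mem k hk)
    apply hmap
    obtain ⟨c, χ, hc⟩ := cs _ (h5.uni hv)
    rw [Ideal.eq_top_iff_one, ← hc]
    refine Ideal.add_mem _ (Ideal.mul_mem_left _ _ (Ideal.mem_map_of_mem _ (hzQ 0))) ?_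
    unfold Tht
    rw [map_sum]
    refine Ideal.sum_mem _ fun i _ => ?_
    rw [map_smul, smul_eq_mul]
    exact Ideal.mul_mem_right _ _ (Ideal.mem_map_of_mem _ (hzQ _))
  obtain ⟨η, hη, hηz⟩ := excision n s hR (KD_monics (n + 2) hX) z bb htop (fun i => rfl)
  have h6 := HE_act (A := A) (C s) e φ he η hη z
  rw [hηz] at h6
  have e7 : Tht (A := A) e (Pi.single 0 1 : Fin (n + 3) → R[X]) = (1, 0) := by
    unfold Tht
    simp
  rw [e7] at h6
  exact h5.trans h6

/-- Let `R` be an integral domain of finite Krull dimension `d` with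
`dim R[Y] = d + 1`, let `f ∈ R[Y]` be nonzero, `A = R[Y][f⁻¹]`, and `P` a finitely
generated projective `A`-module of constant rank `r ≥ max {2, d+1}`. Then `E(A ⊕ P)`
acts transitively on `Um(A ⊕ P)`. -/
theorem statement_6 (R : Type*) [CommRing R] [IsDomain R] (d : ℕ)
    (hdim : ringKrullDim R = d) (hdimY : ringKrullDim R[X] = d + 1)
    (f : R[X]) (hf : f ≠ 0)
    (P : Type*) [AddCommGroup P] [Module (Localization.Away f) P]
    [Module.Finite (Localization.Away f) P] [Module.Projective (Localization.Away f) P]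
    (r : ℕ) (hr : max 2 (d + 1) ≤ r) (hrank : HasConstantRank (Localization.Away f) P r) :
    ∀ v w : Localization.Away f × P,
      IsUnimodular (Localization.Away f) (Localization.Away f × P) v →
      IsUnimodular (Localization.Away f) (Localization.Away f × P) w →
      ∃ σ ∈ TransvectionGroup (Localization.Away f) (Localization.Away f × P), σ v = w := by
  intro v w hv hw
  obtain ⟨n, rfl⟩ : ∃ n, r = n + 2 := ⟨r - 2, by omega⟩
  have hdr : d + 1 ≤ n + 2 := le_trans (le_max_right _ _) hr
  have hR : KD (⊥ : Submonoid R) ⊥ (n + 2) := by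
    intro c _ _
    have := chain_le d hdim c
    omega
  have hX : ∀ c : LTSeries (PrimeSpectrum R[X]), c.length ≤ n + 2 := by
    intro c
    have := chain_le (d + 1) (by exact_mod_cast hdimY) c
    omega
  exact (to_one n hR hX f hf _ P hrank v hv).trans (to_one n hR hX f hf _ P hrank w hw).symm
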